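/- arXiv:1711.01202 — 2 statements merged into one kernel-verified Lean document; each statement's English description precedes it below -/
import Mathlib

section
/- There is an absolute constant C > 0 such that for every real p with 4 < p < 6 and every δ = 1/n with n ∈ ℕ, n ≥ 3, the decoupling constant for the parabola satisfies D_p(δ) ≤ exp(C · (log(1/δ))^{3/4 + (1/4)·log₂((p−2)/2)} · log log(1/δ)). -/
open MeasureTheory

noncomputable section

/-- The weight `w_B` attached to the axis-parallel square of center `c` and side length `R`:
`w_B(x) = (1 + |x - c|/R)^(-100)` with `|·|` the Euclidean norm on `ℝ²`. -/
def wB (c : ℝ × ℝ) (R : ℝ) (x : ℝ × ℝ) : ℝ :=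
  (1 + Real.sqrt ((x.1 - c.1) ^ 2 + (x.2 - c.2) ^ 2) / R) ^ (-100 : ℤ)

/-- The product weight `w̃_B(x) = (1 + |x₁ - c₁|/R)^(-100) * (1 + |x₂ - c₂|/R)^(-100)`. -/
def wtB (c : ℝ × ℝ) (R : ℝ) (x : ℝ × ℝ) : ℝ :=
  (1 + |x.1 - c.1| / R) ^ (-100 : ℤ) * (1 + |x.2 - c.2| / R) ^ (-100 : ℤ)

/-- The axis-parallel square `B(c, R)` with center `c` and side length `R`, as a subset of `ℝ²`. -/
def sqr (c : ℝ × ℝ) (R : ℝ) : Set (ℝ × ℝ) :=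
  Set.Icc (c.1 - R / 2) (c.1 + R / 2) ×ˢ Set.Icc (c.2 - R / 2) (c.2 + R / 2)

/-- The extension operator associated to the parabola, over the interval `[a, b]`:
`(E_{[a,b]} g)(x) = ∫_{[a,b]} g(ξ) e(ξ x₁ + ξ² x₂) dξ`. -/
def extOp (a b : ℝ) (g : ℝ → ℂ) (x : ℝ × ℝ) : ℂ :=
  ∫ ξ in Set.Icc a b,
    g ξ * Complex.exp (2 * Real.pi * Complex.I * ((ξ * x.1 + ξ ^ 2 * x.2 : ℝ) : ℂ))

/-- Weighted `L^p` norm `‖f‖_{L^p(w)} = (∫_{ℝ²} |f|^p w)^{1/p}`. -/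
def wLp (p : ℝ) (w : ℝ × ℝ → ℝ) (f : ℝ × ℝ → ℂ) : ℝ :=
  (∫ x : ℝ × ℝ, ‖f x‖ ^ p * w x) ^ (1 / p)

/-- `L^p` norm over the square of center `c` and side `R`. -/
def sqLp (p : ℝ) (c : ℝ × ℝ) (R : ℝ) (f : ℝ × ℝ → ℂ) : ℝ :=
  (∫ x in sqr c R, ‖f x‖ ^ p) ^ (1 / p)

/-- Normalized weighted `L^p` norm `‖f‖_{L^p_#(w)} = (|B|⁻¹ ∫_{ℝ²} |f|^p w)^{1/p}` where the
normalizing square has side length `R` (so `|B| = R²`). -/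
def shLp (p R : ℝ) (w : ℝ × ℝ → ℝ) (f : ℝ × ℝ → ℂ) : ℝ :=
  ((R ^ 2)⁻¹ * ∫ x : ℝ × ℝ, ‖f x‖ ^ p * w x) ^ (1 / p)

/-- Normalized `L^p` norm over the square of center `c` and side `R`:
`‖f‖_{L^p_#(B)} = (|B|⁻¹ ∫_B |f|^p)^{1/p}`. -/
def shLpSq (p : ℝ) (c : ℝ × ℝ) (R : ℝ) (f : ℝ × ℝ → ℂ) : ℝ :=
  ((R ^ 2)⁻¹ * ∫ x in sqr c R, ‖f x‖ ^ p) ^ (1 / p)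

/-- `DecIneq p n D` says that the constant `D` is admissible in the `l²L^p` decoupling
inequality for the parabola at scale `δ = 1/n`: for every integrable `g : [0,1] → ℂ` and every
axis-parallel square `B` of side length `δ⁻² = n²`,
`‖E_{[0,1]} g‖_{L^p(B)} ≤ D (Σ_{J ∈ P_δ([0,1])} ‖E_J g‖_{L^p(w_B)}²)^{1/2}`. -/
def DecIneq (p : ℝ) (n : ℕ) (D : ℝ) : Prop :=
  ∀ g : ℝ → ℂ, IntegrableOn g (Set.Icc 0 1) → ∀ c : ℝ × ℝ,
    sqLp p c ((n : ℝ) ^ 2) (extOp 0 1 g) ≤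
      D * (∑ k ∈ Finset.range n,
        wLp p (wB c ((n : ℝ) ^ 2)) (extOp ((k : ℝ) / (n : ℝ)) (((k : ℝ) + 1) / (n : ℝ)) g) ^ 2)
        ^ (1 / 2 : ℝ)

/-- The decoupling constant `D_p(δ)` for the parabola at scale `δ = 1/n`, i.e. the smallest
admissible constant in the decoupling inequality. -/
def Dconst (p : ℝ) (n : ℕ) : ℝ := sInf {D : ℝ | 0 ≤ D ∧ DecIneq p n D}

/-- Center of the `(i,j)` square in the partition of the axis-parallel square of center `c` and
side length `Rb` into axis-parallel squares of side length `r`. -/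
def subCtr (c : ℝ × ℝ) (Rb r : ℝ) (i j : ℕ) : ℝ × ℝ :=
  (c.1 - Rb / 2 + ((i : ℝ) + 1 / 2) * r, c.2 - Rb / 2 + ((j : ℝ) + 1 / 2) * r)

/-- `BilIneq p n k b M` says `M` is admissible in the bilinear decoupling inequality with
`δ = 1/n`, `ν = 1/k`: for every square `B` of side `δ⁻² = n²`, every integrable `g`, and all
`ν`-separated intervals `I = [i/k, (i+1)/k]`, `I' = [i'/k, (i'+1)/k]` of the partition
`P_ν([0,1])`,
`Avg_{Δ ∈ P_{ν^{-b}}(B)} Π (Σ_{J ∈ P_{ν^b}} ‖E_J g‖_{L²_#(w̃_Δ)}²)^{p/4}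
  ≤ M^p Π (Σ_{J ∈ P_δ} ‖E_J g‖_{L^p_#(w_B)}²)^{p/4}`. -/
def BilIneq (p : ℝ) (n k b : ℕ) (M : ℝ) : Prop :=
  ∀ g : ℝ → ℂ, IntegrableOn g (Set.Icc 0 1) → ∀ c : ℝ × ℝ,
    ∀ i i' : ℕ, i < k → i' < k → (i + 1 < i' ∨ i' + 1 < i) →
    (((n ^ 2 / k ^ b : ℕ) : ℝ) ^ 2)⁻¹ *
        ∑ a ∈ Finset.range (n ^ 2 / k ^ b), ∑ a' ∈ Finset.range (n ^ 2 / k ^ b),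
          ((∑ J ∈ Finset.range (k ^ (b - 1)),
              shLp 2 ((k : ℝ) ^ b)
                (wtB (subCtr c ((n : ℝ) ^ 2) ((k : ℝ) ^ b) a a') ((k : ℝ) ^ b))
                (extOp ((i : ℝ) / (k : ℝ) + (J : ℝ) / (k : ℝ) ^ b)
                  ((i : ℝ) / (k : ℝ) + ((J : ℝ) + 1) / (k : ℝ) ^ b) g) ^ 2) ^ (p / 4) *
            (∑ J ∈ Finset.range (k ^ (b - 1)),
              shLp 2 ((k : ℝ) ^ b)
                (wtB (subCtr c ((n : ℝ) ^ 2) ((k : ℝ) ^ b) a a') ((k : ℝ) ^ b))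
                (extOp ((i' : ℝ) / (k : ℝ) + (J : ℝ) / (k : ℝ) ^ b)
                  ((i' : ℝ) / (k : ℝ) + ((J : ℝ) + 1) / (k : ℝ) ^ b) g) ^ 2) ^ (p / 4))
      ≤ M ^ p *
        ((∑ J ∈ Finset.range (n / k),
            shLp p ((n : ℝ) ^ 2) (wB c ((n : ℝ) ^ 2))
              (extOp ((i : ℝ) / (k : ℝ) + (J : ℝ) / (n : ℝ))
                ((i : ℝ) / (k : ℝ) + ((J : ℝ) + 1) / (n : ℝ)) g) ^ 2) ^ (p / 4) *
          (∑ J ∈ Finset.range (n / k),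
            shLp p ((n : ℝ) ^ 2) (wB c ((n : ℝ) ^ 2))
              (extOp ((i' : ℝ) / (k : ℝ) + (J : ℝ) / (n : ℝ))
                ((i' : ℝ) / (k : ℝ) + ((J : ℝ) + 1) / (n : ℝ)) g) ^ 2) ^ (p / 4))

/-- The bilinear decoupling constant `M_{p,b}(δ, ν)` with `δ = 1/n`, `ν = 1/k`. -/
def Mconst (p : ℝ) (n k b : ℕ) : ℝ := sInf {M : ℝ | 0 ≤ M ∧ BilIneq p n k b M}

/-- The Fourier transform of a function on `ℝ²`. -/
def ftR2 (η : ℝ × ℝ → ℝ) (ξ : ℝ × ℝ) : ℂ :=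
  ∫ x : ℝ × ℝ, (η x : ℂ) * Complex.exp (-(2 * Real.pi * Complex.I) * ((x.1 * ξ.1 + x.2 * ξ.2 : ℝ) : ℂ))

end

/-- The character `x ↦ e(l · x)` of the plane. -/
noncomputable def planeChar (l x : ℝ × ℝ) : ℂ :=
  Complex.exp (2 * Real.pi * Complex.I * ((l.1 * x.1 + l.2 * x.2 : ℝ) : ℂ))

lemma norm_planeChar (l x : ℝ × ℝ) : ‖planeChar l x‖ = 1 := by
  unfold planeChar
  rw [show 2 * (Real.pi : ℂ) * Complex.I * ((l.1 * x.1 + l.2 * x.2 : ℝ) : ℂ)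
    = ((2 * Real.pi * (l.1 * x.1 + l.2 * x.2) : ℝ) : ℂ) * Complex.I by push_cast; ring]
  exact Complex.norm_exp_ofReal_mul_I _

lemma planeChar_add_left (l m x : ℝ × ℝ) :
    planeChar (l + m) x = planeChar l x * planeChar m x := by
  unfold planeChar
  rw [← Complex.exp_add]
  congr 1
  simp only [Prod.fst_add, Prod.snd_add]
  push_cast
  ring

lemma planeChar_add_right (l x y : ℝ × ℝ) :
    planeChar l (x + y) = planeChar l x * planeChar l y := by
  unfold planeChar
  rw [← Complex.exp_add]
  congr 1
  simp only [Prod.fst_add, Prod.snd_add]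
  push_cast
  ring

lemma conj_planeChar (l x : ℝ × ℝ) :
    (starRingEnd ℂ) (planeChar l x) = planeChar (-l) x := by
  unfold planeChar
  rw [← Complex.exp_conj]
  congr 1
  simp only [map_mul, Complex.conj_ofReal, Complex.conj_I, Prod.fst_neg, Prod.snd_neg, map_ofNat]
  push_cast
  ring

lemma continuous_planeChar : Continuous fun q : (ℝ × ℝ) × (ℝ × ℝ) => planeChar q.1 q.2 := by
  unfold planeChar
  fun_prop

/-- `f` is a superposition, with integrable density, of characters with frequencies in `S`. -/
def HasSpec (S : Set (ℝ × ℝ)) (f : ℝ × ℝ → ℂ) : Prop :=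
  ∃ (Ω : Type) (_ : MeasurableSpace Ω) (μ : Measure Ω) (_ : SFinite μ) (G : Ω → ℂ)
    (l : Ω → ℝ × ℝ), Integrable G μ ∧ Measurable l ∧ (∀ᵐ ω ∂μ, l ω ∈ S) ∧
      ∀ x, f x = ∫ ω, G ω * planeChar (l ω) x ∂μ

lemma integrable_mul_planeChar {Ω : Type} [MeasurableSpace Ω] {μ : Measure Ω} {G : Ω → ℂ}
    {l : Ω → ℝ × ℝ} (hG : Integrable G μ) (hl : Measurable l) (x : ℝ × ℝ) :
    Integrable (fun ω => G ω * planeChar (l ω) x) μ := by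
  refine hG.mul_bdd (c := 1) ?_ (Filter.Eventually.of_forall fun ω => (norm_planeChar _ _).le)
  exact (continuous_planeChar.measurable.comp (hl.prodMk measurable_const)).aestronglyMeasurable

namespace HasSpec

variable {S T : Set (ℝ × ℝ)} {f g : ℝ × ℝ → ℂ}

lemma mono (hf : HasSpec S f) (h : S ⊆ T) : HasSpec T f := by
  obtain ⟨Ω, i, μ, j, G, l, hG, hl, hS, hx⟩ := hf
  exact ⟨Ω, i, μ, j, G, l, hG, hl, hS.mono fun _ hω => h hω, hx⟩

lemma continuous (hf : HasSpec S f) : Continuous f := by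
  obtain ⟨Ω, i, μ, j, G, l, hG, hl, hS, hx⟩ := hf
  rw [show f = fun x => ∫ ω, G ω * planeChar (l ω) x ∂μ from funext hx]
  refine continuous_of_dominated (bound := fun ω => ‖G ω‖)
    (fun x => (integrable_mul_planeChar hG hl x).aestronglyMeasurable) (fun x => ?_) hG.norm ?_
  · exact Filter.Eventually.of_forall fun ω => by simp [norm_planeChar]
  · exact Filter.Eventually.of_forall fun ω => continuous_const.mul
      (continuous_planeChar.comp (continuous_const.prodMk continuous_id))

lemma bounded (hf : HasSpec S f) : ∃ C, ∀ x, ‖f x‖ ≤ C := by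
  obtain ⟨Ω, i, μ, j, G, l, hG, hl, hS, hx⟩ := hf
  refine ⟨∫ ω, ‖G ω‖ ∂μ, fun x => ?_⟩
  rw [hx]
  refine (norm_integral_le_integral_norm _).trans_eq ?_
  simp [norm_planeChar]

lemma conj (hf : HasSpec S f) : HasSpec (-S) (fun x => (starRingEnd ℂ) (f x)) := by
  obtain ⟨Ω, i, μ, j, G, l, hG, hl, hS, hx⟩ := hf
  refine ⟨Ω, i, μ, j, fun ω => (starRingEnd ℂ) (G ω), fun ω => -l ω, ?_, hl.neg, ?_, fun x => ?_⟩
  · exact (LinearIsometryEquiv.integrable_comp_iff (φ := G) Complex.conjLIE).2 hG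
  · filter_upwards [hS] with ω hω
    simpa using hω
  · simp only [hx, ← integral_conj, map_mul, conj_planeChar]

lemma translate (hf : HasSpec S f) (y : ℝ × ℝ) : HasSpec S (fun x => f (x + y)) := by
  obtain ⟨Ω, i, μ, j, G, l, hG, hl, hS, hx⟩ := hf
  refine ⟨Ω, i, μ, j, fun ω => G ω * planeChar (l ω) y, l,
    integrable_mul_planeChar hG hl y, hl, hS, fun x => ?_⟩
  dsimp only
  rw [hx]
  congr 1
  ext ω
  rw [planeChar_add_right]
  ring

lemma mul (hf : HasSpec S f) (hg : HasSpec T g) :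
    HasSpec {v | ∃ l ∈ S, ∃ m ∈ T, v = l + m} (fun x => f x * g x) := by
  obtain ⟨Ω, i, μ, j, G, l, hG, hl, hS, hx⟩ := hf
  obtain ⟨Ω', i', μ', j', G', l', hG', hl', hS', hx'⟩ := hg
  refine ⟨Ω × Ω', inferInstance, μ.prod μ', inferInstance, fun z => G z.1 * G' z.2,
    fun z => l z.1 + l' z.2, hG.mul_prod hG', by fun_prop, ?_, fun x => ?_⟩
  · filter_upwards [Measure.quasiMeasurePreserving_fst.ae hS,
      Measure.quasiMeasurePreserving_snd.ae hS'] with z h1 h2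
    exact ⟨_, h1, _, h2, rfl⟩
  · dsimp only
    rw [hx, hx', ← integral_prod_mul]
    congr 1
    ext z
    rw [planeChar_add_left]
    ring

/-- Averaging `f` along a line against an integrable kernel multiplies the spectral density by the
Fourier transform of the kernel. -/
lemma integral_kernel_eq (hf : HasSpec S f) (w : ℝ × ℝ) {k : ℝ → ℂ} (hk : Integrable k) {c : ℂ}
    (hc : ∀ l ∈ S, ∫ v, k v * planeChar l (v • w) = c) (x : ℝ × ℝ) :
    ∫ v, k v * f (x + v • w) = c * f x := by
  obtain ⟨Ω, i, μ, j, G, l, hG, hl, hS, hx⟩ := hf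
  have h1 : ∀ v, k v * f (x + v • w)
      = ∫ ω, k v * (G ω * planeChar (l ω) x * planeChar (l ω) (v • w)) ∂μ := by
    intro v
    rw [hx, ← integral_const_mul]
    congr 1
    ext ω
    rw [planeChar_add_right]
    ring
  simp only [h1]
  rw [integral_integral_swap]
  · rw [hx, ← integral_const_mul]
    refine integral_congr_ae ?_
    filter_upwards [hS] with ω hω
    rw [← hc _ hω, ← integral_mul_const]
    congr 1
    ext v
    ring
  · have h2 := hk.mul_prod (integrable_mul_planeChar hG hl x)
    have h3 : Integrable (fun z : ℝ × Ω => (k z.1 * (G z.2 * planeChar (l z.2) x)) *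
        planeChar (l z.2) (z.1 • w)) (volume.prod μ) := by
      refine h2.mul_bdd (c := 1) ?_ (Filter.Eventually.of_forall fun ω => (norm_planeChar _ _).le)
      exact (continuous_planeChar.measurable.comp ((hl.comp measurable_snd).prodMk
        (measurable_fst.smul_const w))).aestronglyMeasurable
    refine h3.congr (Filter.Eventually.of_forall fun z => ?_)
    simp only [Function.uncurry]
    ring

end HasSpec

section

open scoped FourierTransform

/-- The triangle function `x ↦ (1 - |x|)₊`. -/
noncomputable def triangle (x : ℝ) : ℂ := ((max 0 (1 - |x|) : ℝ) : ℂ)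

/-- The Fejér kernel. -/
noncomputable def fejer (x : ℝ) : ℝ := Real.sinc (Real.pi * x) ^ 2

lemma continuous_triangle : Continuous triangle := by
  unfold triangle; fun_prop

lemma continuous_fejer : Continuous fejer := by
  unfold fejer
  exact (Real.continuous_sinc.comp (continuous_const.mul continuous_id)).pow 2

lemma fejer_nonneg (x : ℝ) : 0 ≤ fejer x := sq_nonneg _

lemma triangle_eq_zero {x : ℝ} (hx : 1 ≤ |x|) : triangle x = 0 := by
  unfold triangle
  rw [max_eq_left (by linarith)]; simp

lemma triangle_eq {x : ℝ} (hx : |x| ≤ 1) : triangle x = 1 - |x| := by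
  unfold triangle
  rw [max_eq_right (by linarith)]; push_cast; rfl

lemma integrable_triangle : Integrable triangle := by
  refine continuous_triangle.integrable_of_hasCompactSupport ?_
  refine HasCompactSupport.of_support_subset_isCompact (isCompact_Icc (a := (-1 : ℝ)) (b := 1)) ?_
  intro x hx
  by_contra h
  refine hx (triangle_eq_zero ?_)
  by_contra h'
  exact h ⟨(abs_lt.1 (not_le.1 h')).1.le, (abs_lt.1 (not_le.1 h')).2.le⟩

lemma integral_one_sub_mul_cos (a : ℝ) :
    2 * ∫ x in (0 : ℝ)..1, (1 - x) * Real.cos (a * x) = Real.sinc (a / 2) ^ 2 := by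
  by_cases ha : a = 0
  · subst ha
    have h : ∫ x in (0 : ℝ)..1, (1 - x) * Real.cos (0 * x) = 1 / 2 := by
      simp only [zero_mul, Real.cos_zero, mul_one]
      rw [intervalIntegral.integral_sub (by simp) (by simp)]
      norm_num
    rw [h]; simp
  · have h : ∫ x in (0 : ℝ)..1, (1 - x) * Real.cos (a * x)
        = ((1 - 1) * Real.sin (a * 1) / a - Real.cos (a * 1) / a ^ 2)
          - ((1 - 0) * Real.sin (a * 0) / a - Real.cos (a * 0) / a ^ 2) := by
      refine intervalIntegral.integral_eq_sub_of_hasDerivAt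
        (f := fun x => (1 - x) * Real.sin (a * x) / a - Real.cos (a * x) / a ^ 2) ?_ ?_
      · intro x _
        have h1 : HasDerivAt (fun x => a * x) a x := by
          simpa using (hasDerivAt_id x).const_mul a
        have h2 : HasDerivAt (fun x : ℝ => 1 - x) (-1) x := by
          simpa using (hasDerivAt_id x).const_sub 1
        have h3 := ((h2.mul h1.sin).div_const a).sub (h1.cos.div_const (a ^ 2))
        convert! h3 using 1
        field_simp
        ring
      · exact (by fun_prop : Continuous fun x => (1 - x) * Real.cos (a * x)).intervalIntegrable _ _
    rw [h, Real.sinc_of_ne_zero (by positivity)]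
    have h4 : Real.cos a = 1 - 2 * Real.sin (a / 2) ^ 2 := by
      have := Real.cos_two_mul (a / 2)
      rw [show 2 * (a / 2) = a by ring] at this
      nlinarith [Real.sin_sq_add_cos_sq (a / 2)]
    simp only [mul_one, mul_zero, Real.cos_zero, Real.sin_zero, h4]
    field_simp
    ring

lemma fourier_triangle : 𝓕 triangle = fun x => (fejer x : ℂ) := by
  ext s
  rw [Real.fourier_eq']
  have hsupp : Function.support (fun v : ℝ => Complex.exp (↑(-2 * Real.pi * inner ℝ v s) * Complex.I)
      • triangle v) ⊆ Set.Ioc (-1) 1 := by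
    intro x hx
    by_contra h
    refine hx ?_
    have : triangle x = 0 := by
      refine triangle_eq_zero ?_
      by_contra h'
      exact h ⟨(abs_lt.1 (not_le.1 h')).1, (abs_lt.1 (not_le.1 h')).2.le⟩
    simp [this]
  rw [← intervalIntegral.integral_eq_integral_of_support_subset hsupp]
  have hc : Continuous (fun v : ℝ => Complex.exp (↑(-2 * Real.pi * inner ℝ v s) * Complex.I)
      • triangle v) := by
    have := continuous_triangle
    fun_prop
  rw [← intervalIntegral.integral_add_adjacent_intervals (b := 0) (hc.intervalIntegrable _ _)
    (hc.intervalIntegrable _ _)]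
  have h1 := intervalIntegral.integral_comp_neg (a := 0) (b := 1)
    (fun v : ℝ => Complex.exp (↑(-2 * Real.pi * inner ℝ v s) * Complex.I) • triangle v)
  rw [neg_zero] at h1
  have hc' : Continuous (fun v : ℝ => Complex.exp (↑(-2 * Real.pi * inner ℝ (-v) s) * Complex.I)
      • triangle (-v)) := hc.comp continuous_neg
  rw [← h1, ← intervalIntegral.integral_add
    (hc'.intervalIntegrable _ _) (hc.intervalIntegrable _ _)]
  have h2 := integral_one_sub_mul_cos (2 * Real.pi * s)
  rw [show 2 * Real.pi * s / 2 = Real.pi * s by ring] at h2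
  unfold fejer
  rw [← h2, ← intervalIntegral.integral_const_mul, ← intervalIntegral.integral_ofReal]
  refine intervalIntegral.integral_congr fun x hx => ?_
  rw [Set.uIcc_of_le zero_le_one] at hx
  have h3 : triangle x = 1 - x := by
    rw [triangle_eq (abs_le.2 ⟨by linarith [hx.1], hx.2⟩), abs_of_nonneg hx.1]
  have h4 : triangle (-x) = 1 - x := by
    rw [← h3]; simp [triangle]
  simp only [h3, h4, smul_eq_mul]
  push_cast
  rw [Complex.cos]
  simp only [RCLike.inner_apply, conj_trivial]
  push_cast
  rw [show (-2 * (Real.pi : ℂ) * (↑s * -↑x) * Complex.I) = 2 * Real.pi * s * x * Complex.I by ring,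
    show (-2 * (Real.pi : ℂ) * (↑s * ↑x) * Complex.I) = -(2 * Real.pi * s * x) * Complex.I by ring]
  ring

lemma fejer_le (x : ℝ) : fejer x ≤ 2 * (1 + x ^ 2)⁻¹ := by
  have h1 : Real.sinc (Real.pi * x) ^ 2 ≤ 1 := by
    rw [← sq_abs]
    exact pow_le_one₀ (abs_nonneg _) (Real.abs_sinc_le_one _)
  have h2 : x ^ 2 * Real.sinc (Real.pi * x) ^ 2 ≤ 1 := by
    by_cases hx : x = 0
    · simp [hx]
    rw [Real.sinc_of_ne_zero (by positivity), div_pow, mul_pow]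
    have := Real.sin_sq_le_one (Real.pi * x)
    have hpi : 1 ≤ Real.pi ^ 2 := by nlinarith [Real.pi_gt_three]
    rw [mul_div_assoc', div_le_one (by positivity)]
    nlinarith [mul_le_mul_of_nonneg_left this (sq_nonneg x), mul_le_mul_of_nonneg_left hpi (sq_nonneg x)]
  unfold fejer
  rw [← div_eq_mul_inv, le_div_iff₀ (by positivity)]
  nlinarith

lemma integrable_fejer : Integrable fejer := by
  refine (integrable_inv_one_add_sq.const_mul 2).mono' continuous_fejer.aestronglyMeasurable ?_
  refine Filter.Eventually.of_forall fun x => ?_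
  rw [Real.norm_of_nonneg (fejer_nonneg x)]
  exact fejer_le x

/-- The Fourier transform of the Fejér kernel is the triangle function. -/
lemma integral_fejer_mul_exp (s : ℝ) :
    ∫ v : ℝ, (fejer v : ℂ) * Complex.exp (2 * Real.pi * Complex.I * ((s * v : ℝ) : ℂ))
      = triangle s := by
  have h := continuous_triangle.fourierInv_fourier_eq integrable_triangle
    (by rw [fourier_triangle]; exact integrable_fejer.ofReal)
  rw [fourier_triangle] at h
  rw [← congrFun h s, Real.fourierInv_eq']
  congr 1
  ext v
  simp only [RCLike.inner_apply, conj_trivial, smul_eq_mul]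
  rw [mul_comm]
  congr 2
  push_cast
  ring

/-- An integrable kernel `V` whose Fourier transform is `1` on `[-1, 1]`, with a continuous
majorant `m` whose Fourier transform vanishes outside `(-2, 2)`. -/
structure IsMajorizedKernel (V m : ℝ → ℝ) : Prop where
  integrable_left : Integrable V
  integrable_right : Integrable m
  continuous_right : Continuous m
  abs_le : ∀ v, |V v| ≤ m v
  integral_right : ∫ v, m v = 3
  fourier_left : ∀ s : ℝ, |s| ≤ 1 →
    ∫ v : ℝ, (V v : ℂ) * Complex.exp (2 * Real.pi * Complex.I * ((s * v : ℝ) : ℂ)) = 1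
  fourier_right : ∀ s : ℝ, 2 ≤ |s| →
    ∫ v : ℝ, (m v : ℂ) * Complex.exp (2 * Real.pi * Complex.I * ((s * v : ℝ) : ℂ)) = 0

lemma exists_isMajorizedKernel : ∃ V m : ℝ → ℝ, IsMajorizedKernel V m := by
  have hi2 : Integrable fun v => 4 * fejer (2 * v) :=
    (integrable_fejer.comp_mul_left' (two_ne_zero)).const_mul 4
  have hexp : ∀ k : ℝ → ℝ, Integrable k → ∀ s : ℝ, Integrable fun v : ℝ =>
      (k v : ℂ) * Complex.exp (2 * Real.pi * Complex.I * ((s * v : ℝ) : ℂ)) := by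
    intro k hk s
    refine hk.ofReal.mul_bdd (c := 1) (Continuous.aestronglyMeasurable (by fun_prop))
      (Filter.Eventually.of_forall fun v => ?_)
    rw [show 2 * (Real.pi : ℂ) * Complex.I * ((s * v : ℝ) : ℂ)
      = ((2 * Real.pi * (s * v) : ℝ) : ℂ) * Complex.I by push_cast; ring]
    exact (Complex.norm_exp_ofReal_mul_I _).le
  have h2 : ∀ s : ℝ, ∫ v : ℝ, ((4 * fejer (2 * v) : ℝ) : ℂ) *
      Complex.exp (2 * Real.pi * Complex.I * ((s * v : ℝ) : ℂ)) = 2 * triangle (s / 2) := by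
    intro s
    have := Measure.integral_comp_mul_left (fun v : ℝ => 4 * ((fejer v : ℂ) *
      Complex.exp (2 * Real.pi * Complex.I * ((s / 2 * v : ℝ) : ℂ)))) 2
    simp only [integral_const_mul, integral_fejer_mul_exp] at this
    rw [show (2 : ℂ) * triangle (s / 2) = |(2 : ℝ)⁻¹| • (4 * triangle (s / 2)) by
      rw [abs_of_pos (by norm_num), Complex.real_smul]; push_cast; ring, ← this,
      ← integral_const_mul]
    congr 1
    ext v
    push_cast
    rw [show (s : ℂ) / 2 * (2 * v) = s * v by ring]
    ring
  refine ⟨fun v => 4 * fejer (2 * v) - fejer v, fun v => 4 * fejer (2 * v) + fejer v,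
    hi2.sub integrable_fejer, hi2.add integrable_fejer, ?_, fun v => ?_, ?_, fun s hs => ?_,
    fun s hs => ?_⟩
  · have := continuous_fejer
    fun_prop
  · have h3 := fejer_nonneg v
    have h4 := fejer_nonneg (2 * v)
    rw [abs_le]
    constructor <;> linarith
  · have h5 : ((∫ v, (4 * fejer (2 * v) + fejer v) : ℝ) : ℂ) = 3 := by
      rw [integral_add hi2 integrable_fejer, Complex.ofReal_add]
      have a1 := h2 0
      have a2 := integral_fejer_mul_exp 0
      simp only [zero_mul, Complex.ofReal_zero, mul_zero, Complex.exp_zero, mul_one,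
        zero_div, integral_complex_ofReal] at a1 a2
      rw [a1, a2, triangle_eq (by simp)]
      norm_num
    exact_mod_cast h5
  · have h6 : ∀ v : ℝ, ((4 * fejer (2 * v) - fejer v : ℝ) : ℂ) *
        Complex.exp (2 * Real.pi * Complex.I * ((s * v : ℝ) : ℂ))
        = ((4 * fejer (2 * v) : ℝ) : ℂ) * Complex.exp (2 * Real.pi * Complex.I * ((s * v : ℝ) : ℂ))
        - (fejer v : ℂ) * Complex.exp (2 * Real.pi * Complex.I * ((s * v : ℝ) : ℂ)) := by
      intro v; push_cast; ring
    simp only [h6]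
    rw [integral_sub (hexp _ hi2 s) (hexp _ integrable_fejer s), h2, integral_fejer_mul_exp,
      triangle_eq hs, triangle_eq (by rw [abs_div, abs_two]; linarith), abs_div, abs_two]
    push_cast
    ring
  · have h6 : ∀ v : ℝ, ((4 * fejer (2 * v) + fejer v : ℝ) : ℂ) *
        Complex.exp (2 * Real.pi * Complex.I * ((s * v : ℝ) : ℂ))
        = ((4 * fejer (2 * v) : ℝ) : ℂ) * Complex.exp (2 * Real.pi * Complex.I * ((s * v : ℝ) : ℂ))
        + (fejer v : ℂ) * Complex.exp (2 * Real.pi * Complex.I * ((s * v : ℝ) : ℂ)) := by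
      intro v; push_cast; ring
    simp only [h6]
    rw [integral_add (hexp _ hi2 s) (hexp _ integrable_fejer s), h2, integral_fejer_mul_exp,
      triangle_eq_zero (x := s) (by linarith),
      triangle_eq_zero (by rw [abs_div, abs_two]; linarith)]
    simp

end

/-- Bounded continuous functions are integrable against an integrable kernel. -/
lemma integrable_kernel_mul {k A : ℝ → ℂ} (hk : Integrable k) (hA : Continuous A)
    (hb : ∃ C, ∀ v, ‖A v‖ ≤ C) : Integrable fun v => k v * A v := by
  obtain ⟨C, hC⟩ := hb
  exact hk.mul_bdd hA.aestronglyMeasurable (Filter.Eventually.of_forall hC)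

lemma norm_integral_mul_conj_le {m : ℝ → ℝ} (hm : Integrable m) (h0 : ∀ v, 0 ≤ m v)
    {A B : ℝ → ℂ} (hA : Continuous A) (hB : Continuous B) (hbA : ∃ C, ∀ v, ‖A v‖ ≤ C)
    (hbB : ∃ C, ∀ v, ‖B v‖ ≤ C) :
    ‖∫ v, (m v : ℂ) * (A v * (starRingEnd ℂ) (B v))‖
      ≤ ((∫ v, m v * ‖A v‖ ^ 2) + ∫ v, m v * ‖B v‖ ^ 2) / 2 := by
  obtain ⟨C, hC⟩ := hbA
  obtain ⟨D, hD⟩ := hbB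
  have i1 : Integrable fun v => m v * ‖A v‖ ^ 2 :=
    hm.mul_bdd (c := C ^ 2) (hA.norm.pow 2).aestronglyMeasurable
      (Filter.Eventually.of_forall fun v => by
        rw [norm_pow, norm_norm]; exact pow_le_pow_left₀ (norm_nonneg _) (hC v) 2)
  have i2 : Integrable fun v => m v * ‖B v‖ ^ 2 :=
    hm.mul_bdd (c := D ^ 2) (hB.norm.pow 2).aestronglyMeasurable
      (Filter.Eventually.of_forall fun v => by
        rw [norm_pow, norm_norm]; exact pow_le_pow_left₀ (norm_nonneg _) (hD v) 2)
  rw [← integral_add i1 i2, ← integral_div]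
  refine norm_integral_le_of_norm_le ((i1.add i2).div_const 2)
    (Filter.Eventually.of_forall fun v => ?_)
  simp only [norm_mul, RCLike.norm_conj, Complex.norm_real]
  rw [Real.norm_of_nonneg (h0 v)]
  nlinarith [mul_nonneg (h0 v) (sq_nonneg (‖A v‖ - ‖B v‖))]

/-- Almost orthogonality: if only indices at distance less than `K` interact, then the square
function controls the sum. -/
lemma integral_norm_sum_sq_le {m : ℝ → ℝ} (hm : Integrable m) (h0 : ∀ v, 0 ≤ m v)
    (T : Finset ℤ) (A : ℤ → ℝ → ℂ) (K : ℕ) (hA : ∀ k, Continuous (A k))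
    (hb : ∀ k, ∃ C, ∀ v, ‖A k v‖ ≤ C)
    (horth : ∀ k k' : ℤ, (K : ℤ) ≤ |k - k'| →
      ∫ v, (m v : ℂ) * (A k v * (starRingEnd ℂ) (A k' v)) = 0) :
    ∫ v, m v * ‖∑ k ∈ T, A k v‖ ^ 2 ≤ 2 * K * ∑ k ∈ T, ∫ v, m v * ‖A k v‖ ^ 2 := by
  set a : ℤ → ℝ := fun k => ∫ v, m v * ‖A k v‖ ^ 2 with ha
  have ha0 : ∀ k, 0 ≤ a k := fun k =>
    integral_nonneg fun v => mul_nonneg (h0 v) (sq_nonneg _)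
  have hInt : ∀ k k', Integrable fun v => (m v : ℂ) * (A k v * (starRingEnd ℂ) (A k' v)) := by
    intro k k'
    obtain ⟨C, hC⟩ := hb k
    obtain ⟨D, hD⟩ := hb k'
    refine integrable_kernel_mul hm.ofReal ((hA k).mul (Complex.continuous_conj.comp (hA k')))
      ⟨C * D, fun v => ?_⟩
    rw [norm_mul, RCLike.norm_conj]
    exact mul_le_mul (hC v) (hD v) (norm_nonneg _) ((norm_nonneg _).trans (hC v))
  have hexp : ((∫ v, m v * ‖∑ k ∈ T, A k v‖ ^ 2 : ℝ) : ℂ)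
      = ∑ k ∈ T, ∑ k' ∈ T, ∫ v, (m v : ℂ) * (A k v * (starRingEnd ℂ) (A k' v)) := by
    rw [← integral_complex_ofReal]
    simp_rw [← integral_finsetSum T fun k' _ => hInt _ k']
    rw [← integral_finsetSum T fun k _ => integrable_finsetSum T fun k' _ => hInt k k']
    congr 1
    ext v
    push_cast
    rw [← Complex.mul_conj', map_sum, Finset.sum_mul_sum, Finset.mul_sum]
    exact Finset.sum_congr rfl fun k _ => Finset.mul_sum _ _ _
  have hle : ∫ v, m v * ‖∑ k ∈ T, A k v‖ ^ 2
      ≤ ∑ k ∈ T, ∑ k' ∈ T, if |k - k'| < (K : ℤ) then (a k + a k') / 2 else 0 := by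
    calc ∫ v, m v * ‖∑ k ∈ T, A k v‖ ^ 2
        ≤ ‖((∫ v, m v * ‖∑ k ∈ T, A k v‖ ^ 2 : ℝ) : ℂ)‖ := by
          rw [Complex.norm_real]; exact le_abs_self _
      _ ≤ _ := by
          rw [hexp]
          refine (norm_sum_le _ _).trans (Finset.sum_le_sum fun k _ => ?_)
          refine (norm_sum_le _ _).trans (Finset.sum_le_sum fun k' _ => ?_)
          split_ifs with h
          · exact norm_integral_mul_conj_le hm h0 (hA k) (hA k') (hb k) (hb k')
          · rw [horth k k' (not_lt.1 h), norm_zero]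
  have hcard : ∀ k : ℤ, ((T.filter fun k' => |k - k'| < (K : ℤ)).card : ℝ) ≤ 2 * K := by
    intro k
    have : (T.filter fun k' => |k - k'| < (K : ℤ)) ⊆ Finset.Ioo (k - K) (k + K) := by
      intro k' hk'
      have := abs_lt.1 (Finset.mem_filter.1 hk').2
      rw [Finset.mem_Ioo]
      constructor <;> linarith [this.1, this.2]
    have h2 := Finset.card_le_card this
    rw [Int.card_Ioo] at h2
    have h3 : (T.filter fun k' => |k - k'| < (K : ℤ)).card ≤ 2 * K := by omega
    exact_mod_cast h3
  have hcard' : ∀ k : ℤ, ((T.filter fun k' => |k' - k| < (K : ℤ)).card : ℝ) ≤ 2 * K := by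
    intro k
    simpa only [abs_sub_comm] using hcard k
  have hsum : ∑ k ∈ T, ∑ k' ∈ T, (if |k - k'| < (K : ℤ) then (a k + a k') / 2 else 0)
      = (∑ k ∈ T, ∑ k' ∈ T, if |k - k'| < (K : ℤ) then a k / 2 else 0)
        + ∑ k' ∈ T, ∑ k ∈ T, if |k - k'| < (K : ℤ) then a k' / 2 else 0 := by
    rw [Finset.sum_comm (s := T) (t := T)
      (f := fun k' k => if |k - k'| < (K : ℤ) then a k' / 2 else 0), ← Finset.sum_add_distrib]
    refine Finset.sum_congr rfl fun k _ => ?_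
    rw [← Finset.sum_add_distrib]
    refine Finset.sum_congr rfl fun k' _ => ?_
    split_ifs <;> ring
  refine hle.trans ?_
  rw [hsum, Finset.mul_sum, ← Finset.sum_add_distrib]
  refine Finset.sum_le_sum fun k _ => ?_
  simp only [← Finset.sum_filter, Finset.sum_const, nsmul_eq_mul]
  nlinarith [mul_le_mul_of_nonneg_right (hcard k) (ha0 k),
    mul_le_mul_of_nonneg_right (hcard' k) (ha0 k)]

/-- The parallelogram of dimensions about `δ × δ²` tangent to the parabola at `t`. -/
def parBox (t δ : ℝ) : Set (ℝ × ℝ) :=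
  {l | |l.1 - t| ≤ 2 * δ ∧ |l.2 - 2 * t * l.1 + t ^ 2| ≤ 4 * δ ^ 2}

lemma abs_parBox_le {t δ c ρ : ℝ} {l : ℝ × ℝ} (hl : l ∈ parBox t δ) (hδ : 0 ≤ δ) (hδρ : δ ≤ ρ)
    (hc : |t - c| ≤ ρ) : |l.2 - 2 * c * l.1 + c ^ 2| ≤ 9 * ρ ^ 2 := by
  obtain ⟨h1, h2⟩ := hl
  have e : l.2 - 2 * c * l.1 + c ^ 2
      = (l.2 - 2 * t * l.1 + t ^ 2) + (t - c) * (2 * (l.1 - t) + (t - c)) := by ring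
  have h3 : |(t - c) * (2 * (l.1 - t) + (t - c))| ≤ ρ * (4 * ρ + ρ) := by
    rw [abs_mul]
    refine mul_le_mul hc ((abs_add_le _ _).trans ?_) (abs_nonneg _) (by linarith)
    rw [abs_mul, abs_two]
    linarith
  rw [e]
  refine (abs_add_le _ _).trans ?_
  nlinarith [mul_self_le_mul_self hδ hδρ]

lemma le_parBox_sub {t t' δ c ρ σ ρ' K : ℝ} {l l' : ℝ × ℝ} (hl : l ∈ parBox t δ)
    (hl' : l' ∈ parBox t' δ) (hδ : 0 < δ) (hδρ : δ ≤ ρ) (hδρ' : δ ≤ ρ') (hσ : 0 < σ)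
    (hsep : (c + σ ≤ t ∧ c + σ ≤ t') ∨ (t ≤ c - σ ∧ t' ≤ c - σ))
    (hK : 13 * ρ ^ 2 ≤ σ * ρ' * (K - 5)) (htt : (K - 1) * ρ' ≤ |t - t'|) :
    18 * ρ ^ 2 ≤ |(l.2 - 2 * c * l.1) - (l'.2 - 2 * c * l'.1)| := by
  obtain ⟨h1, h2⟩ := hl
  obtain ⟨h1', h2'⟩ := hl'
  set r := l.2 - 2 * t * l.1 + t ^ 2 with hr
  set r' := l'.2 - 2 * t' * l'.1 + t' ^ 2 with hr'
  set v := l.1 - t with hv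
  set v' := l'.1 - t' with hv'
  set u := t - c with hu
  set u' := t' - c with hu'
  have e : (l.2 - 2 * c * l.1) - (l'.2 - 2 * c * l'.1)
      = (u + u') * (u - u') + (2 * u * v - 2 * u' * v' + (r - r')) := by
    rw [hr, hr', hv, hv', hu, hu']; ring
  have hsum : |u + u'| = |u| + |u'| ∧ 2 * σ ≤ |u| + |u'| := by
    rcases hsep with ⟨a, b⟩ | ⟨a, b⟩
    · have a1 : σ ≤ u := by rw [hu]; linarith
      have a2 : σ ≤ u' := by rw [hu']; linarith
      rw [abs_of_nonneg (by linarith : 0 ≤ u + u'), abs_of_nonneg (by linarith : 0 ≤ u),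
        abs_of_nonneg (by linarith : 0 ≤ u')]
      exact ⟨rfl, by linarith⟩
    · have a1 : u ≤ -σ := by rw [hu]; linarith
      have a2 : u' ≤ -σ := by rw [hu']; linarith
      rw [abs_of_nonpos (by linarith : u + u' ≤ 0), abs_of_nonpos (by linarith : u ≤ 0),
        abs_of_nonpos (by linarith : u' ≤ 0)]
      exact ⟨by ring, by linarith⟩
  have huu : (K - 1) * ρ' ≤ |u - u'| := by
    rw [hu, hu']; convert htt using 2; ring
  have hρδ : δ ^ 2 ≤ ρ ^ 2 := by nlinarith
  have herr : |2 * u * v - 2 * u' * v' + (r - r')| ≤ (|u| + |u'|) * (4 * δ) + 8 * δ ^ 2 := by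
    have b1 : |2 * u * v| ≤ |u| * (4 * δ) := by
      rw [abs_mul, abs_mul, abs_two]; nlinarith [abs_nonneg u]
    have b2 : |2 * u' * v'| ≤ |u'| * (4 * δ) := by
      rw [abs_mul, abs_mul, abs_two]; nlinarith [abs_nonneg u']
    have b3 := abs_add_le (2 * u * v - 2 * u' * v') (r - r')
    have b4 := abs_sub (2 * u * v) (2 * u' * v')
    have b5 := abs_sub r r'
    linarith
  have hmain : |(u + u') * (u - u')| = (|u| + |u'|) * |u - u'| := by rw [abs_mul, hsum.1]
  have hlow := abs_sub_abs_le_abs_add ((u + u') * (u - u')) (2 * u * v - 2 * u' * v' + (r - r'))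
  rw [e]
  have hpos : 0 ≤ (K - 1) * ρ' - 4 * δ := by
    have : 0 ≤ σ * (ρ' * (K - 5)) := by nlinarith [sq_nonneg ρ]
    have := nonneg_of_mul_nonneg_right this hσ
    nlinarith
  have hS : 2 * σ * ((K - 1) * ρ' - 4 * δ) ≤ (|u| + |u'|) * (|u - u'| - 4 * δ) :=
    mul_le_mul hsum.2 (by linarith) hpos (by linarith [hsum.2])
  have hT : σ * δ ≤ σ * ρ' := mul_le_mul_of_nonneg_left hδρ' hσ.le
  nlinarith

section

open scoped ENNReal

lemma IsMajorizedKernel.nonneg {V m : ℝ → ℝ} (hk : IsMajorizedKernel V m) (v : ℝ) : 0 ≤ m v :=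
  (abs_nonneg _).trans (hk.abs_le v)

lemma IsMajorizedKernel.lintegral_right {V m : ℝ → ℝ} (hk : IsMajorizedKernel V m) :
    ∫⁻ v, ENNReal.ofReal (m v) = 3 := by
  rw [← ofReal_integral_eq_lintegral_ofReal hk.integrable_right
    (Filter.Eventually.of_forall hk.nonneg), hk.integral_right]
  norm_num

/-- A `δ`-separated family of functions, the `i`-th one having its spectrum in the box of scale `δ`
at the point `t i`. -/
structure IsParFamily (δ : ℝ) (s : Finset ℕ) (t : ℕ → ℝ) (f : ℕ → ℝ × ℝ → ℂ) : Prop where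
  spec : ∀ i ∈ s, HasSpec (parBox (t i) δ) (f i)
  sep : ∀ i ∈ s, ∀ j ∈ s, i ≠ j → δ ≤ |t i - t j|

namespace IsParFamily

variable {δ : ℝ} {s : Finset ℕ} {t : ℕ → ℝ} {f : ℕ → ℝ × ℝ → ℂ}

lemma subset (h : IsParFamily δ s t f) {s' : Finset ℕ} (hs : s' ⊆ s) : IsParFamily δ s' t f :=
  ⟨fun i hi => h.spec i (hs hi), fun i hi j hj => h.sep i (hs hi) j (hs hj)⟩

lemma translate (h : IsParFamily δ s t f) (y : ℝ × ℝ) :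
    IsParFamily δ s t (fun i x => f i (x + y)) :=
  ⟨fun i hi => (h.spec i hi).translate y, h.sep⟩

lemma continuous_sum (h : IsParFamily δ s t f) : Continuous fun x => ∑ i ∈ s, f i x :=
  continuous_finsetSum _ fun i hi => (h.spec i hi).continuous

lemma bounded_sum (h : IsParFamily δ s t f) : ∃ C, ∀ x, ‖∑ i ∈ s, f i x‖ ≤ C := by
  have : ∀ i, ∃ C, i ∈ s → ∀ x, ‖f i x‖ ≤ C := by
    intro i
    by_cases hi : i ∈ s
    · obtain ⟨C, hC⟩ := (h.spec i hi).bounded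
      exact ⟨C, fun _ => hC⟩
    · exact ⟨0, fun h => absurd h hi⟩
  choose C hC using this
  exact ⟨∑ i ∈ s, C i, fun x => (norm_sum_le _ _).trans
    (Finset.sum_le_sum fun i hi => hC i hi x)⟩

end IsParFamily

/-- The direction, suitably scaled, conormal to the box of scale `ρ` at `c`. -/
noncomputable def dirVec (c ρ : ℝ) : ℝ × ℝ := (-2 * c / (9 * ρ ^ 2), 1 / (9 * ρ ^ 2))

lemma planeChar_smul_dirVec (l : ℝ × ℝ) (c ρ v : ℝ) : planeChar l (v • dirVec c ρ)
    = Complex.exp (2 * Real.pi * Complex.I *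
      (((l.2 - 2 * c * l.1) / (9 * ρ ^ 2) * v : ℝ) : ℂ)) := by
  unfold planeChar dirVec
  congr 3
  simp only [Prod.smul_mk, smul_eq_mul]
  ring

lemma lintegral_kernel_rpow_le {μ : Measure ℝ} {w A : ℝ → ℝ≥0∞} (hw : AEMeasurable w μ)
    (hA : AEMeasurable A μ) {q : ℝ} (hq : 1 ≤ q) :
    (∫⁻ v, w v * A v ∂μ) ^ q ≤ (∫⁻ v, w v ∂μ) ^ (q - 1) * ∫⁻ v, w v * A v ^ q ∂μ := by
  have hq0 : 0 < q := by linarith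
  have h := ENNReal.lintegral_mul_norm_pow_le (μ := μ) (f := w) (g := fun v => w v * A v ^ q)
    (p := 1 - q⁻¹) (q := q⁻¹) hw (hw.mul (hA.pow_const q))
    (by rw [sub_nonneg]; exact inv_le_one_of_one_le₀ hq) (by positivity) (by ring)
  have e : ∀ v, w v ^ (1 - q⁻¹) * (w v * A v ^ q) ^ q⁻¹ = w v * A v := by
    intro v
    rw [ENNReal.mul_rpow_of_nonneg _ _ (by positivity), ENNReal.rpow_rpow_inv hq0.ne', ← mul_assoc,
      ← ENNReal.rpow_add_of_nonneg _ _ (by rw [sub_nonneg]; exact inv_le_one_of_one_le₀ hq)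
        (by positivity)]
    simp
  simp only [e] at h
  refine (ENNReal.rpow_le_rpow h hq0.le).trans_eq ?_
  rw [ENNReal.mul_rpow_of_nonneg _ _ hq0.le, ENNReal.rpow_inv_rpow hq0.ne', ← ENNReal.rpow_mul]
  congr 2
  field_simp

/-- The locally constant property, along one direction. -/
lemma enorm_rpow_le_kernel_average {V m : ℝ → ℝ} (hk : IsMajorizedKernel V m) {δ ρ c q : ℝ}
    {s : Finset ℕ} {t : ℕ → ℝ} {f : ℕ → ℝ × ℝ → ℂ} (hf : IsParFamily δ s t f) (hδ : 0 < δ)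
    (hδρ : δ ≤ ρ) (hc : ∀ i ∈ s, |t i - c| ≤ ρ) (hq : 1 ≤ q) (x : ℝ × ℝ) :
    ‖∑ i ∈ s, f i x‖ₑ ^ q ≤ 3 ^ (q - 1) *
      ∫⁻ v, ENNReal.ofReal (m v) * ‖∑ i ∈ s, f i (x + v • dirVec c ρ)‖ₑ ^ q := by
  have hρ : 0 < ρ := hδ.trans_le hδρ
  set k : ℝ → ℂ := fun v =>
    V v * Complex.exp (2 * Real.pi * Complex.I * ((c ^ 2 / (9 * ρ ^ 2) * v : ℝ) : ℂ)) with hkdef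
  have hexp : ∀ r : ℝ, ‖Complex.exp (2 * Real.pi * Complex.I * (r : ℂ))‖ = 1 := by
    intro r
    rw [show 2 * (Real.pi : ℂ) * Complex.I * (r : ℂ)
      = ((2 * Real.pi * r : ℝ) : ℂ) * Complex.I by push_cast; ring]
    exact Complex.norm_exp_ofReal_mul_I _
  have hki : Integrable k := hk.integrable_left.ofReal.mul_bdd (c := 1)
    (Continuous.aestronglyMeasurable (by fun_prop))
    (Filter.Eventually.of_forall fun v => (hexp _).le)
  have hline : ∀ v : ℝ, Continuous fun v : ℝ => x + v • dirVec c ρ := fun v => by fun_prop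
  have hrep : ∑ i ∈ s, f i x = ∫ v, k v * ∑ i ∈ s, f i (x + v • dirVec c ρ) := by
    simp_rw [Finset.mul_sum]
    rw [integral_finsetSum]
    · refine Finset.sum_congr rfl fun i hi => ?_
      rw [(hf.spec i hi).integral_kernel_eq (dirVec c ρ) hki (c := 1) ?_ x, one_mul]
      intro l hl
      have hb := abs_parBox_le hl hδ.le hδρ (hc i hi)
      rw [← hk.fourier_left ((l.2 - 2 * c * l.1 + c ^ 2) / (9 * ρ ^ 2)) ?_]
      · congr 1
        ext v
        rw [planeChar_smul_dirVec, hkdef]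
        dsimp only
        rw [mul_assoc, ← Complex.exp_add]
        congr 2
        push_cast
        ring
      · rw [abs_div, abs_of_pos (by positivity : 0 < 9 * ρ ^ 2)]
        exact (div_le_one (by positivity)).2 hb
    · intro i hi
      obtain ⟨C, hC⟩ := (hf.spec i hi).bounded
      exact integrable_kernel_mul hki ((hf.spec i hi).continuous.comp (hline 0))
        ⟨C, fun v => hC _⟩
  have hle : ‖∑ i ∈ s, f i x‖ₑ
      ≤ ∫⁻ v, ENNReal.ofReal (m v) * ‖∑ i ∈ s, f i (x + v • dirVec c ρ)‖ₑ := by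
    rw [hrep]
    refine (enorm_integral_le_lintegral_enorm _).trans (lintegral_mono fun v => ?_)
    rw [enorm_mul]
    refine mul_le_mul_left ?_ _
    rw [← ofReal_norm]
    refine ENNReal.ofReal_le_ofReal ?_
    rw [hkdef]
    dsimp only
    rw [norm_mul, hexp, mul_one, Complex.norm_real]
    exact hk.abs_le v
  have hmeas : Measurable fun v : ℝ => ‖∑ i ∈ s, f i (x + v • dirVec c ρ)‖ₑ :=
    (hf.continuous_sum.comp (hline 0)).measurable.enorm
  refine (ENNReal.rpow_le_rpow hle (by linarith)).trans ?_
  have := lintegral_kernel_rpow_le (μ := volume)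
    (hk.continuous_right.measurable.ennreal_ofReal).aemeasurable hmeas.aemeasurable hq
  rwa [hk.lintegral_right] at this

/-- The `k`-th block of a family, at scale `ρ`. -/
noncomputable def block (s : Finset ℕ) (t : ℕ → ℝ) (ρ : ℝ) (k : ℤ) : Finset ℕ :=
  s.filter fun i => ⌊t i / ρ⌋ = k

/-- The indices of the nonempty blocks of a family, at scale `ρ`. -/
noncomputable def blockIdx (s : Finset ℕ) (t : ℕ → ℝ) (ρ : ℝ) : Finset ℤ :=
  s.image fun i => ⌊t i / ρ⌋

lemma block_subset (s : Finset ℕ) (t : ℕ → ℝ) (ρ : ℝ) (k : ℤ) : block s t ρ k ⊆ s :=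
  Finset.filter_subset _ _

lemma sum_blockIdx {M : Type*} [AddCommMonoid M] (s : Finset ℕ) (t : ℕ → ℝ) (ρ : ℝ) (g : ℕ → M) :
    ∑ k ∈ blockIdx s t ρ, ∑ i ∈ block s t ρ k, g i = ∑ i ∈ s, g i :=
  Finset.sum_fiberwise_of_maps_to (fun _ hi => Finset.mem_image_of_mem _ hi) _

lemma abs_sub_le_of_mem_block {s : Finset ℕ} {t : ℕ → ℝ} {ρ : ℝ} (hρ : 0 < ρ) {k : ℤ} {i j : ℕ}
    (hi : i ∈ block s t ρ k) (hj : j ∈ block s t ρ k) : |t i - t j| ≤ ρ := by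
  have hi' := (Finset.mem_filter.1 hi).2
  have hj' := (Finset.mem_filter.1 hj).2
  have h := Int.abs_sub_lt_one_of_floor_eq_floor (hi'.trans hj'.symm)
  rw [← sub_div, abs_div, abs_of_pos hρ, div_lt_one hρ] at h
  exact h.le

lemma add_le_of_mem_block {s : Finset ℕ} {t : ℕ → ℝ} {ρ : ℝ} (hρ : 0 < ρ) {k k' : ℤ} {i j : ℕ}
    (hi : i ∈ block s t ρ k) (hj : j ∈ block s t ρ k') :
    t j + ((k : ℝ) - k' - 1) * ρ ≤ t i := by
  have hi' := Int.floor_eq_iff.1 (Finset.mem_filter.1 hi).2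
  have hj' := Int.floor_eq_iff.1 (Finset.mem_filter.1 hj).2
  have h1 := (le_div_iff₀ hρ).1 hi'.1
  have h2 := (div_lt_iff₀ hρ).1 hj'.2
  nlinarith

/-- Almost orthogonality, along one direction, of the blocks of a family transverse to `c`. -/
lemma lintegral_kernel_sum_sq_le {V m : ℝ → ℝ} (hk : IsMajorizedKernel V m) {δ ρ c σ ρ' : ℝ}
    {K : ℕ} {s : Finset ℕ} {t : ℕ → ℝ} {f : ℕ → ℝ × ℝ → ℂ} (hf : IsParFamily δ s t f) (hδ : 0 < δ)
    (hδρ : δ ≤ ρ) (hδρ' : δ ≤ ρ') (hσ : 0 < σ)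
    (hsep : (∀ i ∈ s, c + σ ≤ t i) ∨ ∀ i ∈ s, t i ≤ c - σ)
    (hK : 13 * ρ ^ 2 ≤ σ * ρ' * (K - 5)) (x : ℝ × ℝ) :
    ∫⁻ v, ENNReal.ofReal (m v) * ‖∑ i ∈ s, f i (x + v • (-dirVec c ρ))‖ₑ ^ (2 : ℝ)
      ≤ 2 * K * ∑ k ∈ blockIdx s t ρ', ∫⁻ v, ENNReal.ofReal (m v) *
        ‖∑ i ∈ block s t ρ' k, f i (x + v • (-dirVec c ρ))‖ₑ ^ (2 : ℝ) := by
  have hρ : 0 < ρ := hδ.trans_le hδρ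
  have hρ' : 0 < ρ' := hδ.trans_le hδρ'
  set A : ℤ → ℝ → ℂ := fun k v => ∑ i ∈ block s t ρ' k, f i (x + v • (-dirVec c ρ)) with hA
  have hline : Continuous fun v : ℝ => x + v • (-dirVec c ρ) := by fun_prop
  have hAc : ∀ k, Continuous (A k) := fun k =>
    (hf.subset (block_subset s t ρ' k)).continuous_sum.comp hline
  have hAb : ∀ k, ∃ C, ∀ v, ‖A k v‖ ≤ C := fun k => by
    obtain ⟨C, hC⟩ := (hf.subset (block_subset s t ρ' k)).bounded_sum
    exact ⟨C, fun v => hC _⟩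
  have horth : ∀ k k' : ℤ, (K : ℤ) ≤ |k - k'| →
      ∫ v, (m v : ℂ) * (A k v * (starRingEnd ℂ) (A k' v)) = 0 := by
    intro k k' hkk
    have hspec : ∀ i ∈ block s t ρ' k, ∀ j ∈ block s t ρ' k',
        Integrable (fun v => (m v : ℂ) * (f i (x + v • (-dirVec c ρ)) *
          (starRingEnd ℂ) (f j (x + v • (-dirVec c ρ))))) ∧
        ∫ v, (m v : ℂ) * (f i (x + v • (-dirVec c ρ)) *
          (starRingEnd ℂ) (f j (x + v • (-dirVec c ρ)))) = 0 := by
      intro i hi j hj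
      have hi' := block_subset _ _ _ _ hi
      have hj' := block_subset _ _ _ _ hj
      have hS := (hf.spec i hi').mul (hf.spec j hj').conj
      constructor
      · obtain ⟨C, hC⟩ := hS.bounded
        exact integrable_kernel_mul hk.integrable_right.ofReal (hS.continuous.comp hline)
          ⟨C, fun v => hC _⟩
      · have := hS.integral_kernel_eq (-dirVec c ρ) hk.integrable_right.ofReal (c := 0) ?_ x
        · rwa [zero_mul] at this
        rintro l ⟨a, ha, b, hb, rfl⟩
        rw [Set.mem_neg] at hb
        have htt : ((K : ℝ) - 1) * ρ' ≤ |t i - t j| := by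
          rcases le_abs.1 hkk with h | h
          · have h1 := add_le_of_mem_block hρ' hi hj
            have h2 : (K : ℝ) ≤ (k : ℝ) - k' := by exact_mod_cast h
            refine le_trans ?_ (le_abs_self _)
            nlinarith
          · have h1 := add_le_of_mem_block hρ' hj hi
            have h2 : (K : ℝ) ≤ (k' : ℝ) - k := by
              have : (K : ℤ) ≤ k' - k := by linarith
              exact_mod_cast this
            refine le_trans ?_ (neg_le_abs _)
            nlinarith
        have hgap := le_parBox_sub ha hb hδ hδρ hδρ' hσ
          (hsep.imp (fun h => ⟨h i hi', h j hj'⟩) fun h => ⟨h i hi', h j hj'⟩) hK htt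
        rw [← hk.fourier_right (-(((a.2 - 2 * c * a.1) - ((-b).2 - 2 * c * (-b).1)) /
          (9 * ρ ^ 2))) ?_]
        · congr 1
          ext v
          rw [smul_neg, ← neg_smul, planeChar_smul_dirVec]
          congr 4
          simp only [Prod.fst_add, Prod.snd_add, Prod.fst_neg, Prod.snd_neg]
          ring
        · rw [abs_neg, abs_div, abs_of_pos (by positivity : 0 < 9 * ρ ^ 2),
            le_div_iff₀ (by positivity)]
          linarith
    have e : ∀ v, (m v : ℂ) * (A k v * (starRingEnd ℂ) (A k' v))
        = ∑ i ∈ block s t ρ' k, ∑ j ∈ block s t ρ' k',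
          (m v : ℂ) * (f i (x + v • (-dirVec c ρ)) *
            (starRingEnd ℂ) (f j (x + v • (-dirVec c ρ)))) := by
      intro v
      rw [hA]
      dsimp only
      rw [map_sum, Finset.sum_mul_sum, Finset.mul_sum]
      exact Finset.sum_congr rfl fun i _ => Finset.mul_sum _ _ _
    simp only [e]
    rw [integral_finsetSum _ fun i hi => integrable_finsetSum _ fun j hj => (hspec i hi j hj).1]
    refine Finset.sum_eq_zero fun i hi => ?_
    rw [integral_finsetSum _ fun j hj => (hspec i hi j hj).1]
    exact Finset.sum_eq_zero fun j hj => (hspec i hi j hj).2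
  have hmain := integral_norm_sum_sq_le hk.integrable_right hk.nonneg (blockIdx s t ρ') A K hAc hAb
    horth
  have conv : ∀ B : ℝ → ℂ, Continuous B → (∃ C, ∀ v, ‖B v‖ ≤ C) →
      ∫⁻ v, ENNReal.ofReal (m v) * ‖B v‖ₑ ^ (2 : ℝ)
        = ENNReal.ofReal (∫ v, m v * ‖B v‖ ^ 2) := by
    rintro B hB ⟨C, hC⟩
    rw [ofReal_integral_eq_lintegral_ofReal]
    · refine lintegral_congr fun v => ?_
      rw [ENNReal.ofReal_mul (hk.nonneg v), ENNReal.ofReal_pow (norm_nonneg _),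
        ofReal_norm, ← ENNReal.rpow_natCast]
      norm_num
    · exact hk.integrable_right.mul_bdd (c := C ^ 2) (hB.norm.pow 2).aestronglyMeasurable
        (Filter.Eventually.of_forall fun v => by
          rw [norm_pow, norm_norm]; exact pow_le_pow_left₀ (norm_nonneg _) (hC v) 2)
    · exact Filter.Eventually.of_forall fun v => mul_nonneg (hk.nonneg v) (sq_nonneg _)
  have hsumA : ∀ v, ∑ i ∈ s, f i (x + v • (-dirVec c ρ)) = ∑ k ∈ blockIdx s t ρ', A k v :=
    fun v => (sum_blockIdx s t ρ' _).symm
  simp only [hsumA]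
  rw [conv _ (continuous_finsetSum _ fun k _ => hAc k)]
  · have : ∀ k ∈ blockIdx s t ρ', ∫⁻ v, ENNReal.ofReal (m v) *
        ‖∑ i ∈ block s t ρ' k, f i (x + v • (-dirVec c ρ))‖ₑ ^ (2 : ℝ)
        = ENNReal.ofReal (∫ v, m v * ‖A k v‖ ^ 2) := fun k _ => conv (A k) (hAc k) (hAb k)
    rw [Finset.sum_congr rfl this, ← ENNReal.ofReal_sum_of_nonneg fun k _ =>
      integral_nonneg fun v => mul_nonneg (hk.nonneg v) (sq_nonneg _)]
    refine (ENNReal.ofReal_le_ofReal hmain).trans_eq ?_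
    rw [ENNReal.ofReal_mul (by positivity), ENNReal.ofReal_mul (by positivity),
      ENNReal.ofReal_natCast]
    norm_num
  · obtain ⟨C, hC⟩ := hf.bounded_sum
    exact ⟨C, fun v => by rw [← hsumA]; exact hC _⟩

/-- The square of the `L^p` norm of a function on the plane. -/
noncomputable def sqMass (p : ℝ) (f : ℝ × ℝ → ℂ) : ℝ≥0∞ := (∫⁻ x, ‖f x‖ₑ ^ p) ^ (2 / p)

lemma sqMass_translate (p : ℝ) (f : ℝ × ℝ → ℂ) (y : ℝ × ℝ) :
    sqMass p (fun x => f (x + y)) = sqMass p f := by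
  unfold sqMass
  rw [lintegral_add_right_eq_self (fun x => ‖f x‖ₑ ^ p) y]

/-- `D` is an admissible constant, to the power `p`, for the decoupling of `δ`-separated families
with frequencies in an interval of length `ℓ`. -/
def DecBound (p δ ℓ : ℝ) (D : ℝ≥0∞) : Prop :=
  ∀ (s : Finset ℕ) (t : ℕ → ℝ) (f : ℕ → ℝ × ℝ → ℂ), IsParFamily δ s t f →
    (∀ i ∈ s, ∀ j ∈ s, |t i - t j| ≤ ℓ) →
    ∫⁻ x, ‖∑ i ∈ s, f i x‖ₑ ^ p ≤ D * (∑ i ∈ s, sqMass p (f i)) ^ (p / 2)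

/-- One of the two sets of frequencies lies to the right of the other one, at distance at
least `σ`. -/
def IsSep (σ : ℝ) (s : Finset ℕ) (t : ℕ → ℝ) (s' : Finset ℕ) (t' : ℕ → ℝ) : Prop :=
  (∀ i ∈ s, ∀ j ∈ s', t i + σ ≤ t' j) ∨ ∀ i ∈ s, ∀ j ∈ s', t' j + σ ≤ t i

lemma IsSep.symm {σ : ℝ} {s : Finset ℕ} {t : ℕ → ℝ} {s' : Finset ℕ} {t' : ℕ → ℝ}
    (h : IsSep σ s t s' t') : IsSep σ s' t' s t :=
  h.elim (fun h => Or.inr fun i hi j hj => h j hj i hi) fun h => Or.inl fun i hi j hj => h j hj i hi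

lemma IsSep.subset {σ : ℝ} {s : Finset ℕ} {t : ℕ → ℝ} {s' : Finset ℕ} {t' : ℕ → ℝ}
    (h : IsSep σ s t s' t') {u u' : Finset ℕ} (hu : u ⊆ s) (hu' : u' ⊆ s') : IsSep σ u t u' t' :=
  h.imp (fun h i hi j hj => h i (hu hi) j (hu' hj)) fun h i hi j hj => h i (hu hi) j (hu' hj)

/-- `M` is an admissible constant, to the power `p`, for the asymmetric bilinear decoupling of
`σ`-separated families with frequencies in intervals of lengths `ℓ₁` and `ℓ₂`. -/
def BilBound (p δ σ ℓ₁ ℓ₂ : ℝ) (M : ℝ≥0∞) : Prop :=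
  ∀ (s : Finset ℕ) (t : ℕ → ℝ) (f : ℕ → ℝ × ℝ → ℂ) (s' : Finset ℕ) (t' : ℕ → ℝ)
    (f' : ℕ → ℝ × ℝ → ℂ), IsParFamily δ s t f → IsParFamily δ s' t' f' →
    (∀ i ∈ s, ∀ j ∈ s, |t i - t j| ≤ ℓ₁) → (∀ i ∈ s', ∀ j ∈ s', |t' i - t' j| ≤ ℓ₂) →
    IsSep σ s t s' t' →
    ∫⁻ x, ‖∑ i ∈ s, f i x‖ₑ ^ (2 : ℝ) * ‖∑ i ∈ s', f' i x‖ₑ ^ (p - 2)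
      ≤ M * ((∑ i ∈ s, sqMass p (f i)) * (∑ i ∈ s', sqMass p (f' i)) ^ ((p - 2) / 2))

lemma IsParFamily.measurable_enorm {δ : ℝ} {s : Finset ℕ} {t : ℕ → ℝ} {f : ℕ → ℝ × ℝ → ℂ}
    (h : IsParFamily δ s t f) : Measurable fun x => ‖∑ i ∈ s, f i x‖ₑ :=
  h.continuous_sum.measurable.enorm

/-- The bilinear bound obtained by estimating the two factors separately. -/
lemma DecBound.bilBound {p δ σ ℓ₁ ℓ₂ : ℝ} {D₁ D₂ : ℝ≥0∞} (hp : 4 < p)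
    (h₁ : DecBound p δ ℓ₁ D₁) (h₂ : DecBound p δ ℓ₂ D₂) :
    BilBound p δ σ ℓ₁ ℓ₂ (D₁ ^ (2 / p) * D₂ ^ ((p - 2) / p)) := by
  intro s t f s' t' f' hf hf' hs hs' _
  have hp0 : 0 < p := by linarith
  have e1 : 0 ≤ 2 / p := by positivity
  have e2 : 0 ≤ (p - 2) / p := div_nonneg (by linarith) hp0.le
  have h := ENNReal.lintegral_mul_norm_pow_le (μ := (volume : Measure (ℝ × ℝ)))
    (f := fun x => ‖∑ i ∈ s, f i x‖ₑ ^ p) (g := fun x => ‖∑ i ∈ s', f' i x‖ₑ ^ p)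
    (hf.measurable_enorm.pow_const p).aemeasurable (hf'.measurable_enorm.pow_const p).aemeasurable
    e1 e2 (by field_simp; ring)
  simp only [← ENNReal.rpow_mul] at h
  rw [mul_div_cancel₀ _ hp0.ne', mul_div_cancel₀ _ hp0.ne'] at h
  refine h.trans ((mul_le_mul' (ENNReal.rpow_le_rpow (h₁ s t f hf hs) e1)
    (ENNReal.rpow_le_rpow (h₂ s' t' f' hf' hs') e2)).trans_eq ?_)
  rw [ENNReal.mul_rpow_of_nonneg _ _ e1, ENNReal.mul_rpow_of_nonneg _ _ e2, ← ENNReal.rpow_mul,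
    ← ENNReal.rpow_mul, show p / 2 * (2 / p) = 1 by field_simp,
    show p / 2 * ((p - 2) / p) = (p - 2) / 2 by field_simp, ENNReal.rpow_one]
  ring

/-- Interpolation between the bilinear bound with the two factors exchanged and the linear bound. -/
lemma BilBound.swap {p δ σ ℓ₁ ℓ₂ : ℝ} {M D : ℝ≥0∞} (hp : 4 < p)
    (hM : BilBound p δ σ ℓ₁ ℓ₂ M) (hD : DecBound p δ ℓ₁ D) :
    BilBound p δ σ ℓ₂ ℓ₁ (M ^ (2 / (p - 2)) * D ^ (1 - 2 / (p - 2))) := by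
  intro s t f s' t' f' hf hf' hs hs' hsep
  have hq : 0 < p - 2 := by linarith
  have e1 : 0 ≤ 2 / (p - 2) := by positivity
  have e2 : 0 ≤ 1 - 2 / (p - 2) := by
    rw [sub_nonneg, div_le_one hq]
    linarith
  have h := ENNReal.lintegral_mul_norm_pow_le (μ := (volume : Measure (ℝ × ℝ)))
    (f := fun x => ‖∑ i ∈ s', f' i x‖ₑ ^ (2 : ℝ) * ‖∑ i ∈ s, f i x‖ₑ ^ (p - 2))
    (g := fun x => ‖∑ i ∈ s', f' i x‖ₑ ^ p)
    ((hf'.measurable_enorm.pow_const _).mul (hf.measurable_enorm.pow_const _)).aemeasurable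
    (hf'.measurable_enorm.pow_const p).aemeasurable e1 e2 (by ring)
  have e : ∀ a b : ℝ≥0∞, (a ^ (2 : ℝ) * b ^ (p - 2)) ^ (2 / (p - 2)) * (a ^ p) ^ (1 - 2 / (p - 2))
      = b ^ (2 : ℝ) * a ^ (p - 2) := by
    intro a b
    rw [ENNReal.mul_rpow_of_nonneg _ _ e1, ← ENNReal.rpow_mul, ← ENNReal.rpow_mul,
      ← ENNReal.rpow_mul, mul_div_cancel₀ _ hq.ne', mul_right_comm,
      ← ENNReal.rpow_add_of_nonneg _ _ (by positivity) (mul_nonneg (by linarith) e2), mul_comm]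
    congr 2
    field_simp
    ring
  simp only [e] at h
  refine h.trans ((mul_le_mul' (ENNReal.rpow_le_rpow (hM s' t' f' s t f hf' hf hs' hs hsep.symm) e1)
    (ENNReal.rpow_le_rpow (hD s' t' f' hf' hs') e2)).trans_eq ?_)
  rw [ENNReal.mul_rpow_of_nonneg _ _ e1, ENNReal.mul_rpow_of_nonneg _ _ e2,
    ENNReal.mul_rpow_of_nonneg _ _ e1, ← ENNReal.rpow_mul, ← ENNReal.rpow_mul,
    show (p - 2) / 2 * (2 / (p - 2)) = 1 by field_simp, ENNReal.rpow_one]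
  have : ∀ a b c d e : ℝ≥0∞, a * (b * c) * (d * e) = a * d * (c * (b * e)) := by
    intros; ring
  rw [this, ← ENNReal.rpow_add_of_nonneg _ _ e1 (mul_nonneg (by linarith) e2)]
  congr 4
  field_simp
  ring

/-- Passing from a long interval to a short one in the first factor. -/
lemma BilBound.of_short {V m : ℝ → ℝ} (hk : IsMajorizedKernel V m) {p δ σ ℓ₁ ρ ρ' : ℝ} {K : ℕ}
    {M : ℝ≥0∞} (hp : 4 < p) (hδ : 0 < δ) (hδρ : δ ≤ ρ) (hδρ' : δ ≤ ρ') (hσ : 0 < σ)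
    (hK : 13 * ρ ^ 2 ≤ σ * ρ' * (K - 5)) (hM : BilBound p δ σ ρ' ρ M) :
    BilBound p δ σ ℓ₁ ρ (3 ^ (p - 3) * (2 * K) * 3 * M) := by
  intro s t f s' t' f' hf hf' hs hs' hsep
  have hρ' : 0 < ρ' := hδ.trans_le hδρ'
  rcases s'.eq_empty_or_nonempty with rfl | ⟨j₀, hj₀⟩
  · simp [ENNReal.zero_rpow_of_pos (by linarith : 0 < p - 2)]
  set c := t' j₀ with hc
  set w := dirVec c ρ with hw
  have hmm : Measurable fun v => ENNReal.ofReal (m v) :=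
    hk.continuous_right.measurable.ennreal_ofReal
  set F : ℝ × ℝ → ℝ≥0∞ := fun x => ‖∑ i ∈ s', f' i x‖ₑ ^ (p - 2) with hF
  have hFm : Measurable F := hf'.measurable_enorm.pow_const _
  set A : Finset ℕ → ℝ × ℝ → ℝ≥0∞ := fun u x => ‖∑ i ∈ u, f i x‖ₑ ^ (2 : ℝ) with hA
  have hAm : ∀ u ⊆ s, Measurable (A u) := fun u hu =>
    (hf.subset hu).measurable_enorm.pow_const _
  have hsep' : (∀ i ∈ s, c + σ ≤ t i) ∨ ∀ i ∈ s, t i ≤ c - σ := by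
    rcases hsep with h | h
    · exact Or.inr fun i hi => by linarith [h i hi j₀ hj₀]
    · exact Or.inl fun i hi => h i hi j₀ hj₀
  have swap : ∀ a b : ℝ × ℝ → ℝ≥0∞, Measurable a → Measurable b → ∀ y : ℝ × ℝ,
      ∫⁻ x, a x * ∫⁻ v, ENNReal.ofReal (m v) * b (x + v • y)
        = ∫⁻ v, ENNReal.ofReal (m v) * ∫⁻ x, a x * b (x + v • y) := by
    intro a b ha hb y
    have hb' : Measurable fun z : (ℝ × ℝ) × ℝ => b (z.1 + z.2 • y) := hb.comp (by fun_prop)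
    have h1 : ∀ x, a x * ∫⁻ v, ENNReal.ofReal (m v) * b (x + v • y)
        = ∫⁻ v, a x * (ENNReal.ofReal (m v) * b (x + v • y)) := fun x =>
      (lintegral_const_mul _ (hmm.mul (hb'.comp (measurable_const.prodMk measurable_id)))).symm
    have h2 : ∀ v, ENNReal.ofReal (m v) * ∫⁻ x, a x * b (x + v • y)
        = ∫⁻ x, a x * (ENNReal.ofReal (m v) * b (x + v • y)) := fun v => by
      rw [← lintegral_const_mul' _ _ ENNReal.ofReal_ne_top]
      exact lintegral_congr fun x => by ring
    simp only [h1, h2]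
    refine lintegral_lintegral_swap ?_
    exact ((ha.comp measurable_fst).mul
      ((hmm.comp measurable_snd).mul hb')).aemeasurable
  have step1 : ∫⁻ x, A s x * F x
      ≤ 3 ^ (p - 3) * ∫⁻ x, F x * ∫⁻ v, ENNReal.ofReal (m v) * A s (x + v • (-w)) := by
    calc ∫⁻ x, A s x * F x
        ≤ ∫⁻ x, 3 ^ (p - 3) * (A s x * ∫⁻ v, ENNReal.ofReal (m v) * F (x + v • w)) := by
          refine lintegral_mono fun x => ?_
          have := enorm_rpow_le_kernel_average hk hf' hδ hδρ
            (fun i hi => hs' i hi j₀ hj₀) (by linarith : 1 ≤ p - 2) x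
          rw [show p - 2 - 1 = p - 3 by ring] at this
          calc A s x * F x ≤ A s x * _ := mul_le_mul_right this _
            _ = _ := by rw [← hc, ← hw]; ring
      _ = 3 ^ (p - 3) * ∫⁻ x, A s x * ∫⁻ v, ENNReal.ofReal (m v) * F (x + v • w) := by
          rw [lintegral_const_mul' _ _ (ENNReal.rpow_ne_top_of_nonneg (by linarith) (by simp))]
      _ = _ := by
          rw [swap _ _ (hAm s subset_rfl) hFm, swap _ _ hFm (hAm s subset_rfl)]
          congr 2
          ext v
          congr 1
          rw [← lintegral_add_right_eq_self _ (v • (-w))]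
          refine lintegral_congr fun x => ?_
          rw [mul_comm, add_assoc, smul_neg, neg_add_cancel, add_zero]
  have step2 : ∫⁻ x, F x * ∫⁻ v, ENNReal.ofReal (m v) * A s (x + v • (-w))
      ≤ 2 * K * ∑ k ∈ blockIdx s t ρ', ∫⁻ v, ENNReal.ofReal (m v) *
        ∫⁻ x, F x * A (block s t ρ' k) (x + v • (-w)) := by
    calc _ ≤ ∫⁻ x, F x * (2 * K * ∑ k ∈ blockIdx s t ρ', ∫⁻ v, ENNReal.ofReal (m v) *
          A (block s t ρ' k) (x + v • (-w))) :=
          lintegral_mono fun x => mul_le_mul_right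
            (lintegral_kernel_sum_sq_le hk hf hδ hδρ hδρ' hσ hsep' hK x) _
      _ = 2 * K * ∫⁻ x, ∑ k ∈ blockIdx s t ρ', F x * ∫⁻ v, ENNReal.ofReal (m v) *
          A (block s t ρ' k) (x + v • (-w)) := by
          rw [← lintegral_const_mul' _ _ (ENNReal.mul_ne_top (by simp) (by simp))]
          refine lintegral_congr fun x => ?_
          rw [← Finset.mul_sum]
          ring
      _ = _ := by
          rw [lintegral_finsetSum' _ fun k _ => ?_]
          · congr 1
            exact Finset.sum_congr rfl fun k _ =>
              swap _ _ hFm (hAm _ (block_subset s t ρ' k)) _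
          · refine (hFm.mul ?_).aemeasurable
            refine Measurable.lintegral_prod_right' (f := fun z : (ℝ × ℝ) × ℝ =>
              ENNReal.ofReal (m z.2) * A (block s t ρ' k) (z.1 + z.2 • (-w))) ?_
            exact (hmm.comp measurable_snd).mul
              ((hAm _ (block_subset s t ρ' k)).comp (by fun_prop))
  set S' := (∑ i ∈ s', sqMass p (f' i)) ^ ((p - 2) / 2) with hS'
  have step3 : ∀ (k : ℤ) (v : ℝ), ∫⁻ x, F x * A (block s t ρ' k) (x + v • (-w))
      ≤ M * ((∑ i ∈ block s t ρ' k, sqMass p (f i)) * S') := by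
    intro k v
    have := hM (block s t ρ' k) t (fun i x => f i (x + v • (-w))) s' t' f'
      ((hf.subset (block_subset s t ρ' k)).translate _) hf'
      (fun i hi j hj => abs_sub_le_of_mem_block hρ' hi hj) hs'
      (hsep.subset (block_subset s t ρ' k) subset_rfl)
    simp only [sqMass_translate] at this
    refine le_trans (le_of_eq ?_) this
    exact lintegral_congr fun x => mul_comm _ _
  calc _ ≤ _ := step1
    _ ≤ 3 ^ (p - 3) * (2 * K * ∑ k ∈ blockIdx s t ρ', ∫⁻ v, ENNReal.ofReal (m v) *
          (M * ((∑ i ∈ block s t ρ' k, sqMass p (f i)) * S'))) :=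
        mul_le_mul_right (step2.trans (mul_le_mul_right (Finset.sum_le_sum fun k _ =>
          lintegral_mono fun v => mul_le_mul_right (step3 k v) _) _)) _
    _ = _ := by
        simp_rw [lintegral_mul_const _ hmm, hk.lintegral_right]
        rw [← Finset.mul_sum, ← Finset.mul_sum, ← Finset.sum_mul, sum_blockIdx]
        ring

lemma card_blockIdx_le {s : Finset ℕ} {t : ℕ → ℝ} {ρ ℓ : ℝ} (hρ : 0 < ρ) (hℓ : 0 ≤ ℓ)
    (hs : ∀ i ∈ s, ∀ j ∈ s, |t i - t j| ≤ ℓ) : ((blockIdx s t ρ).card : ℝ) ≤ ℓ / ρ + 2 := by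
  have hpos : 0 ≤ ℓ / ρ := by positivity
  rcases s.eq_empty_or_nonempty with rfl | hne
  · simp only [blockIdx, Finset.image_empty, Finset.card_empty, Nat.cast_zero]
    linarith
  obtain ⟨i₀, hi₀, hmin⟩ := s.exists_min_image t hne
  have hsub : blockIdx s t ρ ⊆ Finset.Icc ⌊t i₀ / ρ⌋ (⌊t i₀ / ρ⌋ + ⌊ℓ / ρ + 1⌋) := by
    intro k hk
    obtain ⟨i, hi, rfl⟩ := Finset.mem_image.1 hk
    refine Finset.mem_Icc.2 ⟨Int.floor_le_floor (div_le_div_of_nonneg_right (hmin i hi) hρ.le), ?_⟩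
    rw [← sub_le_iff_le_add', Int.le_floor]
    push_cast
    have h1 : t i ≤ t i₀ + ℓ := by linarith [(abs_le.1 (hs i hi i₀ hi₀)).2]
    have h2 := Int.floor_le (t i / ρ)
    have h3 := Int.lt_floor_add_one (t i₀ / ρ)
    have h4 : t i / ρ ≤ t i₀ / ρ + ℓ / ρ := by
      rw [← add_div]
      exact div_le_div_of_nonneg_right h1 hρ.le
    linarith
  have hc := Finset.card_le_card hsub
  rw [Int.card_Icc] at hc
  have h5 : (0 : ℤ) ≤ ⌊ℓ / ρ + 1⌋ := Int.floor_nonneg.2 (by linarith)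
  have h6 : ((blockIdx s t ρ).card : ℤ) ≤ ⌊ℓ / ρ + 1⌋ + 1 := by omega
  have h7 : ((blockIdx s t ρ).card : ℝ) ≤ (⌊ℓ / ρ + 1⌋ : ℝ) + 1 := by exact_mod_cast h6
  linarith [Int.floor_le (ℓ / ρ + 1)]

lemma IsParFamily.card_le {δ ℓ : ℝ} {s : Finset ℕ} {t : ℕ → ℝ} {f : ℕ → ℝ × ℝ → ℂ}
    (hf : IsParFamily δ s t f) (hδ : 0 < δ) (hℓ : 0 ≤ ℓ)
    (hs : ∀ i ∈ s, ∀ j ∈ s, |t i - t j| ≤ ℓ) : (s.card : ℝ) ≤ ℓ / δ + 2 := by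
  rw [← Finset.card_image_of_injOn (f := fun i => ⌊t i / δ⌋)]
  · exact card_blockIdx_le hδ hℓ hs
  · intro i hi j hj hij
    by_contra hne
    have h1 := hf.sep i hi j hj hne
    have h2 := Int.abs_sub_lt_one_of_floor_eq_floor hij
    rw [← sub_div, abs_div, abs_of_pos hδ, div_lt_one hδ] at h2
    linarith

lemma sqMass_rpow {p : ℝ} (hp : 0 < p) (f : ℝ × ℝ → ℂ) :
    sqMass p f ^ (p / 2) = ∫⁻ x, ‖f x‖ₑ ^ p := by
  rw [sqMass, ← ENNReal.rpow_mul, show 2 / p * (p / 2) = 1 by field_simp, ENNReal.rpow_one]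

lemma enorm_sum_rpow_le {ι : Type*} (s : Finset ι) (z : ι → ℂ) {p : ℝ} (hp : 1 ≤ p) :
    ‖∑ i ∈ s, z i‖ₑ ^ p ≤ (s.card : ℝ≥0∞) ^ (p - 1) * ∑ i ∈ s, ‖z i‖ₑ ^ p :=
  (ENNReal.rpow_le_rpow (enorm_sum_le _ _) (by linarith)).trans
    (ENNReal.rpow_sum_le_const_mul_sum_rpow s _ hp)

/-- The trivial decoupling bound. -/
lemma decBound_of_card_le {p δ ℓ : ℝ} (hp : 4 < p) (hδ : 0 < δ) (hℓ : 0 ≤ ℓ) :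
    DecBound p δ ℓ (ENNReal.ofReal (ℓ / δ + 2) ^ p) := by
  intro s t f hf hs
  have hp0 : 0 < p := by linarith
  have hcard : (s.card : ℝ≥0∞) ≤ ENNReal.ofReal (ℓ / δ + 2) := by
    rw [← ENNReal.ofReal_natCast]
    exact ENNReal.ofReal_le_ofReal (hf.card_le hδ hℓ hs)
  set S := ∑ i ∈ s, sqMass p (f i) with hS
  calc ∫⁻ x, ‖∑ i ∈ s, f i x‖ₑ ^ p
      ≤ ∫⁻ x, (s.card : ℝ≥0∞) ^ (p - 1) * ∑ i ∈ s, ‖f i x‖ₑ ^ p :=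
        lintegral_mono fun x => enorm_sum_rpow_le s _ (by linarith)
    _ = (s.card : ℝ≥0∞) ^ (p - 1) * ∑ i ∈ s, sqMass p (f i) ^ (p / 2) := by
        rw [lintegral_const_mul' _ _ (ENNReal.rpow_ne_top_of_nonneg (by linarith) (by simp)),
          lintegral_finsetSum' _ fun i hi =>
            ((hf.spec i hi).continuous.measurable.enorm.pow_const p).aemeasurable]
        simp only [sqMass_rpow hp0]
    _ ≤ (s.card : ℝ≥0∞) ^ (p - 1) * ∑ i ∈ s, S ^ (p / 2) := by
        refine mul_le_mul_right (Finset.sum_le_sum fun i hi => ?_) _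
        exact ENNReal.rpow_le_rpow
          (Finset.single_le_sum_of_canonicallyOrdered (f := fun i => sqMass p (f i)) hi)
          (by positivity)
    _ = (s.card : ℝ≥0∞) ^ p * S ^ (p / 2) := by
        rw [Finset.sum_const, nsmul_eq_mul, ← mul_assoc]
        congr 1
        nth_rewrite 2 [← ENNReal.rpow_one (s.card : ℝ≥0∞)]
        rw [← ENNReal.rpow_add_of_nonneg _ _ (by linarith) zero_le_one, sub_add_cancel]
    _ ≤ _ := mul_le_mul_left (ENNReal.rpow_le_rpow hcard hp0.le) _

/-- The broad-narrow dichotomy. -/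
lemma sum_rpow_le_narrow_add_broad (T : Finset ℤ) (z : ℤ → ℝ≥0∞) {p : ℝ} (hp : 0 < p) :
    (∑ k ∈ T, z k) ^ p ≤ 4 ^ p * ∑ k ∈ T, z k ^ p + (T.card : ℝ≥0∞) ^ (3 * p / 2) *
      ∑ k ∈ T, ∑ k' ∈ T with 2 ≤ |k - k'|, z k ^ (p / 2) * z k' ^ (p / 2) := by
  rcases T.eq_empty_or_nonempty with rfl | hne
  · simp [ENNReal.zero_rpow_of_pos hp]
  obtain ⟨a, ha, hmax⟩ := T.exists_max_image z hne
  set R := T.filter fun k' => 2 ≤ |a - k'| with hR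
  have hsplit : ∑ k ∈ T, z k ≤ 3 * z a + ∑ k ∈ R, z k := by
    rw [← Finset.sum_filter_not_add_sum_filter T (fun k' => 2 ≤ |a - k'|)]
    refine add_le_add_left ?_ _
    calc _ ≤ ∑ k ∈ T with ¬ 2 ≤ |a - k|, z a :=
          Finset.sum_le_sum fun k hk => hmax k (Finset.mem_filter.1 hk).1
      _ ≤ ∑ k ∈ Finset.Icc (a - 1) (a + 1), z a := by
          refine Finset.sum_le_sum_of_subset fun k hk => ?_
          have := (Finset.mem_filter.1 hk).2
          rw [not_le, abs_lt] at this
          exact Finset.mem_Icc.2 ⟨by omega, by omega⟩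
      _ = 3 * z a := by
          rw [Finset.sum_const, Int.card_Icc, nsmul_eq_mul,
            show a + 1 + 1 - (a - 1) = 3 by ring]
          rfl
  rcases le_or_gt (∑ k ∈ R, z k) (z a) with h | h
  · refine le_trans ?_ le_self_add
    calc (∑ k ∈ T, z k) ^ p ≤ (4 * z a) ^ p := by
          refine ENNReal.rpow_le_rpow (hsplit.trans ((add_le_add_right h _).trans_eq ?_)) hp.le
          ring
      _ = 4 ^ p * z a ^ p := ENNReal.mul_rpow_of_nonneg _ _ hp.le
      _ ≤ _ := mul_le_mul_right
        (Finset.single_le_sum_of_canonicallyOrdered (f := fun k => z k ^ p) ha) _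
  · refine le_trans ?_ le_add_self
    have hRne : R.Nonempty := by
      rw [Finset.nonempty_iff_ne_empty]
      intro h0
      rw [h0] at h
      simp at h
    obtain ⟨b, hb, hbmax⟩ := R.exists_max_image z hRne
    have hab : z a ≤ T.card * z b := by
      refine h.le.trans ((Finset.sum_le_card_nsmul _ _ _ hbmax).trans ?_)
      rw [nsmul_eq_mul]
      exact mul_le_mul_left (by exact_mod_cast Finset.card_le_card (Finset.filter_subset _ _)) _
    have hall : ∑ k ∈ T, z k ≤ T.card * z a := by
      rw [← nsmul_eq_mul]
      exact Finset.sum_le_card_nsmul _ _ _ hmax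
    have hp2 : 0 ≤ p / 2 := by positivity
    calc (∑ k ∈ T, z k) ^ p ≤ (T.card * z a) ^ p := ENNReal.rpow_le_rpow hall hp.le
      _ = (T.card : ℝ≥0∞) ^ p * (z a ^ (p / 2) * z a ^ (p / 2)) := by
          rw [ENNReal.mul_rpow_of_nonneg _ _ hp.le, ← ENNReal.rpow_add_of_nonneg _ _ hp2 hp2,
            add_halves]
      _ ≤ (T.card : ℝ≥0∞) ^ p * (z a ^ (p / 2) * (T.card * z b) ^ (p / 2)) := by gcongr
      _ = (T.card : ℝ≥0∞) ^ (3 * p / 2) * (z a ^ (p / 2) * z b ^ (p / 2)) := by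
          rw [ENNReal.mul_rpow_of_nonneg _ _ hp2, show 3 * p / 2 = p + p / 2 by ring,
            ENNReal.rpow_add_of_nonneg _ _ hp.le hp2]
          ring
      _ ≤ _ := by
          refine mul_le_mul_right ?_ _
          refine le_trans ?_ (Finset.single_le_sum_of_canonicallyOrdered ha)
          exact Finset.single_le_sum_of_canonicallyOrdered
            (f := fun k' => z a ^ (p / 2) * z k' ^ (p / 2)) hb

/-- The reduction of the linear bound to the bilinear bound. -/
lemma DecBound.of_bilBound {p δ ℓ ρ : ℝ} {D M : ℝ≥0∞} {N : ℕ} (hp : 4 < p) (hρ : 0 < ρ)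
    (hℓ : 0 ≤ ℓ) (hN : ℓ / ρ + 2 ≤ N) (hD : DecBound p δ ρ D) (hM : BilBound p δ ρ ρ ρ M) :
    DecBound p δ ℓ (4 ^ p * D + (N : ℝ≥0∞) ^ (3 * p / 2 + 2) * M) := by
  intro s t f hf hs
  have hp0 : 0 < p := by linarith
  have hp2 : 0 ≤ p / 2 := by positivity
  set T := blockIdx s t ρ with hT
  set z : ℤ → ℝ × ℝ → ℝ≥0∞ := fun k x => ‖∑ i ∈ block s t ρ k, f i x‖ₑ with hz
  set S : ℤ → ℝ≥0∞ := fun k => ∑ i ∈ block s t ρ k, sqMass p (f i) with hS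
  have hfam : ∀ k, IsParFamily δ (block s t ρ k) t f := fun k => hf.subset (block_subset s t ρ k)
  have hzm : ∀ k, Measurable (z k) := fun k => (hfam k).measurable_enorm
  have hdiam : ∀ k, ∀ i ∈ block s t ρ k, ∀ j ∈ block s t ρ k, |t i - t j| ≤ ρ :=
    fun k i hi j hj => abs_sub_le_of_mem_block hρ hi hj
  have hTS : ∑ k ∈ T, S k = ∑ i ∈ s, sqMass p (f i) := sum_blockIdx s t ρ _
  rw [← hTS]
  set S₀ := ∑ k ∈ T, S k with hS₀
  have hSle : ∀ k ∈ T, S k ≤ S₀ := fun k hk => Finset.single_le_sum_of_canonicallyOrdered hk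
  have hcard : (T.card : ℝ≥0∞) ≤ N := by
    have h : (T.card : ℝ) ≤ N := (card_blockIdx_le hρ hℓ hs).trans hN
    exact_mod_cast h
  have e0 : ∀ x, ∑ i ∈ s, f i x = ∑ k ∈ T, ∑ i ∈ block s t ρ k, f i x :=
    fun x => (sum_blockIdx s t ρ _).symm
  have narrow : ∑ k ∈ T, ∫⁻ x, z k x ^ p ≤ D * S₀ ^ (p / 2) := by
    calc ∑ k ∈ T, ∫⁻ x, z k x ^ p ≤ ∑ k ∈ T, S k * (D * S₀ ^ (p / 2 - 1)) := by
          refine Finset.sum_le_sum fun k hk => (hD _ t f (hfam k) (hdiam k)).trans ?_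
          calc D * S k ^ (p / 2) = S k * (D * S k ^ (p / 2 - 1)) := by
                rw [mul_left_comm]
                congr 1
                nth_rewrite 2 [← ENNReal.rpow_one (S k)]
                rw [← ENNReal.rpow_add_of_nonneg _ _ zero_le_one (by linarith)]
                congr 1
                ring
            _ ≤ _ := by
                gcongr
                · linarith
                · exact hSle k hk
      _ = D * S₀ ^ (p / 2) := by
          rw [← Finset.sum_mul, ← hS₀, mul_left_comm]
          congr 1
          nth_rewrite 1 [← ENNReal.rpow_one S₀]
          rw [← ENNReal.rpow_add_of_nonneg _ _ zero_le_one (by linarith)]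
          congr 1
          ring
  have broad : ∀ k ∈ T, ∀ k' ∈ T, 2 ≤ |k - k'| →
      ∫⁻ x, z k x ^ (p / 2) * z k' x ^ (p / 2) ≤ M * S₀ ^ (p / 2) := by
    intro k hk k' hk' hkk
    have hsep : IsSep ρ (block s t ρ k) t (block s t ρ k') t := by
      rcases le_abs.1 hkk with h | h
      · refine Or.inr fun i hi j hj => ?_
        have h1 := add_le_of_mem_block hρ hi hj
        have h2 : (2 : ℝ) ≤ (k : ℝ) - k' := by exact_mod_cast h
        nlinarith
      · refine Or.inl fun i hi j hj => ?_
        have h1 := add_le_of_mem_block hρ hj hi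
        have h2 : (2 : ℝ) ≤ (k' : ℝ) - k := by
          have : (2 : ℤ) ≤ k' - k := by linarith
          exact_mod_cast this
        nlinarith
    have hH := ENNReal.lintegral_mul_norm_pow_le (μ := (volume : Measure (ℝ × ℝ)))
      (f := fun x => z k x ^ (2 : ℝ) * z k' x ^ (p - 2))
      (g := fun x => z k' x ^ (2 : ℝ) * z k x ^ (p - 2)) (p := 1 / 2) (q := 1 / 2)
      (((hzm k).pow_const _).mul ((hzm k').pow_const _)).aemeasurable
      (((hzm k').pow_const _).mul ((hzm k).pow_const _)).aemeasurable
      (by norm_num) (by norm_num) (by norm_num)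
    have e : ∀ a b : ℝ≥0∞, (a ^ (2 : ℝ) * b ^ (p - 2)) ^ (1 / 2 : ℝ) *
        (b ^ (2 : ℝ) * a ^ (p - 2)) ^ (1 / 2 : ℝ) = a ^ (p / 2) * b ^ (p / 2) := by
      intro a b
      rw [← ENNReal.mul_rpow_of_nonneg _ _ (by norm_num : (0 : ℝ) ≤ 1 / 2),
        show a ^ (2 : ℝ) * b ^ (p - 2) * (b ^ (2 : ℝ) * a ^ (p - 2))
          = (a ^ (2 : ℝ) * a ^ (p - 2)) * (b ^ (2 : ℝ) * b ^ (p - 2)) by ring,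
        ← ENNReal.rpow_add_of_nonneg _ _ (by norm_num) (by linarith),
        ← ENNReal.rpow_add_of_nonneg _ _ (by norm_num) (by linarith),
        ENNReal.mul_rpow_of_nonneg _ _ (by norm_num : (0 : ℝ) ≤ 1 / 2), ← ENNReal.rpow_mul,
        ← ENNReal.rpow_mul, show (2 + (p - 2)) * (1 / 2) = p / 2 by ring]
    simp only [e] at hH
    have key : ∀ a ∈ T, ∀ b ∈ T, M * (S a * S b ^ ((p - 2) / 2)) ≤ M * S₀ ^ (p / 2) := by
      intro a ha b hb
      calc M * (S a * S b ^ ((p - 2) / 2)) ≤ M * (S₀ ^ (1 : ℝ) * S₀ ^ ((p - 2) / 2)) := by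
            rw [ENNReal.rpow_one]
            gcongr
            · exact hSle a ha
            · linarith
            · exact hSle b hb
        _ = _ := by
            rw [← ENNReal.rpow_add_of_nonneg _ _ (by norm_num) (by linarith)]
            congr 2
            ring
    have h1 := (hM _ t f _ t f (hfam k) (hfam k') (hdiam k) (hdiam k') hsep).trans (key k hk k' hk')
    have h2 := (hM _ t f _ t f (hfam k') (hfam k) (hdiam k') (hdiam k) hsep.symm).trans
      (key k' hk' k hk)
    refine hH.trans ((mul_le_mul' (ENNReal.rpow_le_rpow h1 (by norm_num))
      (ENNReal.rpow_le_rpow h2 (by norm_num))).trans_eq ?_)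
    rw [← ENNReal.rpow_add_of_nonneg _ _ (by norm_num) (by norm_num)]
    norm_num
  have hbroadsum : ∑ k ∈ T, ∑ k' ∈ T with 2 ≤ |k - k'|,
      ∫⁻ x, z k x ^ (p / 2) * z k' x ^ (p / 2) ≤ (N : ℝ≥0∞) ^ (2 : ℝ) * (M * S₀ ^ (p / 2)) := by
    calc _ ≤ ∑ k ∈ T, ∑ k' ∈ T with 2 ≤ |k - k'|, M * S₀ ^ (p / 2) :=
          Finset.sum_le_sum fun k hk => Finset.sum_le_sum fun k' hk' =>
            broad k hk k' (Finset.mem_filter.1 hk').1 (Finset.mem_filter.1 hk').2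
      _ ≤ ∑ k ∈ T, ∑ k' ∈ T, M * S₀ ^ (p / 2) :=
          Finset.sum_le_sum fun k _ => Finset.sum_le_sum_of_subset (Finset.filter_subset _ _)
      _ = (T.card : ℝ≥0∞) * T.card * (M * S₀ ^ (p / 2)) := by
          simp only [Finset.sum_const, nsmul_eq_mul]
          ring
      _ ≤ _ := by
          rw [ENNReal.rpow_two, sq]
          gcongr
  have hpow : ∀ k k', AEMeasurable (fun x => z k x ^ (p / 2) * z k' x ^ (p / 2)) :=
    fun k k' => (((hzm k).pow_const _).mul ((hzm k').pow_const _)).aemeasurable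
  calc ∫⁻ x, ‖∑ i ∈ s, f i x‖ₑ ^ p
      ≤ ∫⁻ x, (4 ^ p * ∑ k ∈ T, z k x ^ p + (T.card : ℝ≥0∞) ^ (3 * p / 2) *
          ∑ k ∈ T, ∑ k' ∈ T with 2 ≤ |k - k'|, z k x ^ (p / 2) * z k' x ^ (p / 2)) := by
        refine lintegral_mono fun x => ?_
        rw [e0]
        exact (ENNReal.rpow_le_rpow (enorm_sum_le _ _) hp0.le).trans
          (sum_rpow_le_narrow_add_broad T (fun k => z k x) hp0)
    _ = 4 ^ p * (∑ k ∈ T, ∫⁻ x, z k x ^ p) + (T.card : ℝ≥0∞) ^ (3 * p / 2) *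
          ∑ k ∈ T, ∑ k' ∈ T with 2 ≤ |k - k'|, ∫⁻ x, z k x ^ (p / 2) * z k' x ^ (p / 2) := by
        rw [lintegral_add_left' ((Finset.aemeasurable_fun_sum _ fun k _ =>
            ((hzm k).pow_const p).aemeasurable).const_mul _),
          lintegral_const_mul' _ _ (ENNReal.rpow_ne_top_of_nonneg hp0.le (by simp)),
          lintegral_const_mul' _ _ (ENNReal.rpow_ne_top_of_nonneg (by positivity) (by simp)),
          lintegral_finsetSum' _ fun k _ => ((hzm k).pow_const p).aemeasurable,
          lintegral_finsetSum' _ fun k _ => Finset.aemeasurable_fun_sum _ fun k' _ =>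
            hpow k k']
        congr 2
        exact Finset.sum_congr rfl fun k _ =>
          lintegral_finsetSum' _ fun k' _ => hpow k k'
    _ ≤ 4 ^ p * (D * S₀ ^ (p / 2)) +
          (N : ℝ≥0∞) ^ (3 * p / 2) * ((N : ℝ≥0∞) ^ (2 : ℝ) * (M * S₀ ^ (p / 2))) := by
        gcongr
    _ = _ := by
        rw [ENNReal.rpow_add_of_nonneg _ _ (by positivity) (by norm_num)]
        ring

/-- The exponential function with values in the extended nonnegative reals. -/
noncomputable def expENN (x : ℝ) : ℝ≥0∞ := ENNReal.ofReal (Real.exp x)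

lemma expENN_add (x y : ℝ) : expENN (x + y) = expENN x * expENN y := by
  rw [expENN, Real.exp_add, ENNReal.ofReal_mul (Real.exp_pos _).le]
  rfl

lemma expENN_rpow (x a : ℝ) : expENN x ^ a = expENN (x * a) := by
  rw [expENN, ENNReal.ofReal_rpow_of_pos (Real.exp_pos _), ← Real.exp_mul]
  rfl

lemma expENN_le {x y : ℝ} (h : x ≤ y) : expENN x ≤ expENN y :=
  ENNReal.ofReal_le_ofReal (Real.exp_le_exp.2 h)

lemma natCast_le_expENN {n : ℕ} {x : ℝ} (h : (n : ℝ) ≤ Real.exp x) : (n : ℝ≥0∞) ≤ expENN x := by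
  rw [← ENNReal.ofReal_natCast]
  exact ENNReal.ofReal_le_ofReal h

lemma expENN_half_add_half (x : ℝ) : expENN (x - 1) + expENN (x - 1) ≤ expENN x := by
  rw [expENN, expENN, ← ENNReal.ofReal_add (Real.exp_pos _).le (Real.exp_pos _).le]
  refine ENNReal.ofReal_le_ofReal ?_
  have h1 : Real.exp x = Real.exp (x - 1) * Real.exp 1 := by rw [← Real.exp_add]; ring_nf
  have h2 := Real.exp_one_gt_d9
  have h3 := Real.exp_pos (x - 1)
  rw [h1]
  nlinarith

lemma DecBound.mono {p δ ℓ : ℝ} {D D' : ℝ≥0∞} (h : DecBound p δ ℓ D) (hD : D ≤ D') :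
    DecBound p δ ℓ D' :=
  fun s t f hf hs => (h s t f hf hs).trans (mul_le_mul_left hD _)

lemma BilBound.mono {p δ σ ℓ₁ ℓ₂ : ℝ} {M M' : ℝ≥0∞} (h : BilBound p δ σ ℓ₁ ℓ₂ M) (hM : M ≤ M') :
    BilBound p δ σ ℓ₁ ℓ₂ M' :=
  fun s t f s' t' f' hf hf' hs hs' hsep =>
    (h s t f s' t' f' hf hf' hs hs' hsep).trans (mul_le_mul_left hM _)

lemma exp_nat_le (n : ℕ) : (2.7 : ℝ) ^ n ≤ Real.exp n := by
  rw [← Real.exp_one_pow]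
  exact pow_le_pow_left₀ (by norm_num) (by linarith [Real.exp_one_gt_d9]) n

/-- One step of the bilinear iteration, with constants in exponential form. -/
lemma BilBound.step {p δ h ℓ ρ ρ' ℓ₁ x y : ℝ} (hp : 4 < p) (hp6 : p < 6) (hδ : 0 < δ)
    (hδρ : δ ≤ ρ) (hδρ' : δ ≤ ρ') (hh : 1 ≤ h) (hρρ' : ρ ^ 2 = ℓ * ρ') (hℓ : 0 < ℓ)
    (hM : BilBound p δ (ℓ * Real.exp (-h)) ρ ρ' (expENN x)) (hD : DecBound p δ ρ (expENN y)) :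
    BilBound p δ (ℓ * Real.exp (-h)) ℓ₁ ρ
      (expENN (10 * h + x * (2 / (p - 2)) + y * (1 - 2 / (p - 2)))) := by
  obtain ⟨V, m, hk⟩ := exists_isMajorizedKernel
  have hρ' : 0 < ρ' := hδ.trans_le hδρ'
  have he : 1 ≤ Real.exp h := Real.one_le_exp (by linarith)
  set K : ℕ := ⌈13 * Real.exp h⌉₊ + 5 with hK
  have hK1 : 13 * Real.exp h ≤ (K : ℝ) - 5 := by
    rw [hK]
    push_cast
    linarith [Nat.le_ceil (13 * Real.exp h)]
  have hK2 : (K : ℝ) ≤ 19 * Real.exp h := by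
    rw [hK]
    push_cast
    linarith [Nat.ceil_lt_add_one (by positivity : 0 ≤ 13 * Real.exp h)]
  have hKey : 13 * ρ ^ 2 ≤ ℓ * Real.exp (-h) * ρ' * (K - 5) := by
    have h1 : Real.exp (-h) * Real.exp h = 1 := by rw [← Real.exp_add]; simp
    have h2 : ℓ * Real.exp (-h) * ρ' * (13 * Real.exp h) ≤ ℓ * Real.exp (-h) * ρ' * (K - 5) :=
      mul_le_mul_of_nonneg_left hK1 (by positivity)
    calc 13 * ρ ^ 2 = 13 * (ℓ * ρ') * (Real.exp (-h) * Real.exp h) := by rw [hρρ', h1, mul_one]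
      _ = ℓ * Real.exp (-h) * ρ' * (13 * Real.exp h) := by ring
      _ ≤ _ := h2
  refine (BilBound.of_short hk hp hδ hδρ hδρ' (by positivity) hKey (hM.swap hp hD)).mono ?_
  rw [expENN_rpow, expENN_rpow, ← expENN_add, add_assoc, expENN_add (10 * h)]
  refine mul_le_mul_left ?_ _
  calc (3 : ℝ≥0∞) ^ (p - 3) * (2 * K) * 3 ≤ (3 : ℝ≥0∞) ^ (3 : ℝ) * (2 * K) * 3 := by
        gcongr
        · norm_num
        · linarith
    _ = ((162 * K : ℕ) : ℝ≥0∞) := by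
        rw [show (3 : ℝ) = ((3 : ℕ) : ℝ) by norm_num, ENNReal.rpow_natCast]
        push_cast
        ring
    _ ≤ _ := by
        refine natCast_le_expENN ?_
        push_cast
        have h9 := exp_nat_le 9
        have h9' : Real.exp (9 : ℕ) ≤ Real.exp (9 * h) := Real.exp_le_exp.2 (by push_cast; linarith)
        rw [show 10 * h = 9 * h + h by ring, Real.exp_add]
        have : (162 * 19 : ℝ) ≤ Real.exp (9 * h) := by
          refine le_trans ?_ (h9.trans h9')
          norm_num
        nlinarith

lemma decBound_exp {p δ h κ : ℝ} {N : ℕ} (hp : 4 < p) (hp6 : p < 6) (hδ : 0 < δ) (hN : 1 ≤ N)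
    (hh : 1 ≤ h) (hκ : 2 ≤ κ * h)
    (hbroad : 34 + 10 * (N : ℝ) ≤ 2 * κ * (2 / (p - 2)) ^ N * 2 ^ N) {ℓ : ℝ} (hℓ : δ ≤ ℓ) :
    DecBound p δ ℓ (expENN (p * (2 + h * 2 ^ N + κ * Real.log (ℓ / δ)))) := by
  have hp0 : 0 < p := by linarith
  have hq : 0 < p - 2 := by linarith
  have hκ0 : 0 < κ := by
    by_contra hneg
    nlinarith
  set θ := 2 / (p - 2) with hθ
  have hθ0 : 0 < θ := by positivity
  have hθ1 : θ ≤ 1 := by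
    rw [hθ, div_le_one hq]
    linarith
  suffices H : ∀ k : ℕ, ∀ ℓ : ℝ, δ ≤ ℓ → ℓ ≤ δ * Real.exp (h * 2 ^ N + k * h) →
      DecBound p δ ℓ (expENN (p * (2 + h * 2 ^ N + κ * Real.log (ℓ / δ)))) by
    obtain ⟨k, hk⟩ := exists_nat_ge (Real.log (ℓ / δ))
    refine H k ℓ hℓ ?_
    have h1 : ℓ = δ * Real.exp (Real.log (ℓ / δ)) := by
      rw [Real.exp_log (div_pos (hδ.trans_le hℓ) hδ)]
      field_simp
    refine h1.le.trans (mul_le_mul_of_nonneg_left (Real.exp_le_exp.2 ?_) hδ.le)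
    have h2 : 0 ≤ h * 2 ^ N := by positivity
    nlinarith [(Nat.cast_nonneg k : (0 : ℝ) ≤ k)]
  have base : ∀ ℓ : ℝ, δ ≤ ℓ → ℓ ≤ δ * Real.exp (h * 2 ^ N) →
      DecBound p δ ℓ (expENN (p * (2 + h * 2 ^ N + κ * Real.log (ℓ / δ)))) := by
    intro ℓ h1 h2
    refine (decBound_of_card_le hp hδ (hδ.le.trans h1)).mono ?_
    have hlog : 0 ≤ Real.log (ℓ / δ) := Real.log_nonneg ((one_le_div hδ).2 h1)
    have h3 : ℓ / δ + 2 ≤ Real.exp (2 + h * 2 ^ N) := by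
      have h4 : ℓ / δ ≤ Real.exp (h * 2 ^ N) := (div_le_iff₀' hδ).2 h2
      have h5 : 1 ≤ Real.exp (h * 2 ^ N) := Real.one_le_exp (by positivity)
      have h6 := exp_nat_le 2
      push_cast at h6
      rw [Real.exp_add]
      nlinarith
    calc _ ≤ expENN (2 + h * 2 ^ N) ^ p :=
          ENNReal.rpow_le_rpow (ENNReal.ofReal_le_ofReal h3) hp0.le
      _ ≤ _ := by
          rw [expENN_rpow, mul_comm]
          exact expENN_le (by nlinarith [mul_nonneg hκ0.le hlog])
  intro k
  induction k with
  | zero =>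
    intro ℓ h1 h2
    refine base ℓ h1 (by simpa using h2)
  | succ k ih =>
    intro ℓ h1 h2
    rcases le_or_gt ℓ (δ * Real.exp (h * 2 ^ N)) with h3 | h3
    · exact base ℓ h1 h3
    have hℓ0 : 0 < ℓ := hδ.trans_le h1
    set Φ := 2 + h * 2 ^ N + κ * Real.log (ℓ / δ) with hΦ
    set L : ℕ → ℝ := fun j => ℓ * Real.exp (-(h * 2 ^ j)) with hL
    have hLδ : ∀ j ≤ N, δ ≤ L j := by
      intro j hj
      have h4 : (2 : ℝ) ^ j ≤ 2 ^ N := pow_le_pow_right₀ (by norm_num) hj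
      have h5 : δ * Real.exp (h * 2 ^ N) * Real.exp (-(h * 2 ^ N)) = δ := by
        rw [mul_assoc, ← Real.exp_add]
        simp
      calc δ = δ * Real.exp (h * 2 ^ N) * Real.exp (-(h * 2 ^ N)) := h5.symm
        _ ≤ ℓ * Real.exp (-(h * 2 ^ N)) :=
          mul_le_mul_of_nonneg_right h3.le (Real.exp_pos _).le
        _ ≤ _ := mul_le_mul_of_nonneg_left (Real.exp_le_exp.2 (by nlinarith)) hℓ0.le
    have hDL : ∀ j ≤ N, DecBound p δ (L j) (expENN (p * (Φ - κ * (h * 2 ^ j)))) := by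
      intro j hj
      have h4 : (1 : ℝ) ≤ 2 ^ j := one_le_pow₀ (by norm_num)
      have h5 := ih (L j) (hLδ j hj) (by
        calc L j ≤ δ * Real.exp (h * 2 ^ N + (k + 1 : ℕ) * h) * Real.exp (-(h * 2 ^ j)) :=
              mul_le_mul_of_nonneg_right h2 (Real.exp_pos _).le
          _ = δ * Real.exp (h * 2 ^ N + (k + 1 : ℕ) * h - h * 2 ^ j) := by
              rw [mul_assoc, ← Real.exp_add, sub_eq_add_neg]
          _ ≤ _ := by
              refine mul_le_mul_of_nonneg_left (Real.exp_le_exp.2 ?_) hδ.le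
              push_cast
              nlinarith)
      have h6 : Real.log (L j / δ) = Real.log (ℓ / δ) - h * 2 ^ j := by
        rw [hL]
        dsimp only
        rw [mul_div_right_comm, Real.log_mul (by positivity) (Real.exp_pos _).ne', Real.log_exp]
        ring
      rw [h6] at h5
      convert h5 using 2
      rw [hΦ]
      ring
    have hL0 : L 0 = ℓ * Real.exp (-h) := by simp [hL]
    have hLsq : ∀ j, L j ^ 2 = ℓ * L (j + 1) := by
      intro j
      rw [hL]
      dsimp only
      rw [mul_pow, ← Real.exp_nat_mul, sq ℓ, mul_assoc]
      congr 3
      push_cast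
      ring
    have top : BilBound p δ (ℓ * Real.exp (-h)) (L (N - 1)) (L N)
        (expENN (p * Φ - p * κ * h * 2 ^ (N - 1))) := by
      refine ((hDL (N - 1) (Nat.sub_le _ _)).bilBound hp (hDL N le_rfl)).mono ?_
      rw [expENN_rpow, expENN_rpow, ← expENN_add]
      refine expENN_le ?_
      have h4 : (2 : ℝ) ^ (N - 1) ≤ 2 ^ N := pow_le_pow_right₀ (by norm_num) (Nat.sub_le _ _)
      rw [show p * (Φ - κ * (h * 2 ^ (N - 1))) * (2 / p) + p * (Φ - κ * (h * 2 ^ N)) * ((p - 2) / p)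
        = p * Φ - p * κ * h * 2 ^ (N - 1) - (p - 2) * (κ * h) * (2 ^ N - 2 ^ (N - 1)) by
          field_simp
          ring]
      have h5 : 0 ≤ (p - 2) * (κ * h) * (2 ^ N - 2 ^ (N - 1)) :=
        mul_nonneg (mul_nonneg hq.le (by linarith)) (by linarith)
      linarith
    have down : ∀ i : ℕ, i + 1 ≤ N → ∀ ℓ₁ : ℝ,
        BilBound p δ (ℓ * Real.exp (-h)) ℓ₁ (L (N - (i + 1)))
          (expENN (p * Φ - p * κ * h * θ ^ (i + 1) * 2 ^ (N - 1) + 10 * h * (i + 1))) := by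
      have stepx : ∀ j < N, ∀ x ℓ₁ : ℝ,
          BilBound p δ (ℓ * Real.exp (-h)) (L j) (L (j + 1)) (expENN x) →
          BilBound p δ (ℓ * Real.exp (-h)) ℓ₁ (L j) (expENN (10 * h + x * θ + p * Φ * (1 - θ))) := by
        intro j hj x ℓ₁ hx
        refine (BilBound.step hp hp6 hδ (hLδ j hj.le) (hLδ (j + 1) hj) hh (hLsq j) hℓ0 hx
          (hDL j hj.le)).mono (expENN_le ?_)
        have h4 : 0 ≤ p * (κ * h * 2 ^ j) * (1 - θ) :=
          mul_nonneg (mul_nonneg hp0.le (by positivity)) (by linarith)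
        rw [← hθ]
        nlinarith
      intro i
      induction i with
      | zero =>
        intro hi ℓ₁
        have hx := stepx (N - 1) (by omega) _ ℓ₁ (by rw [Nat.sub_add_cancel hN]; exact top)
        refine hx.mono (expENN_le (le_of_eq ?_))
        push_cast
        ring
      | succ i ih' =>
        intro hi ℓ₁
        have hx := stepx (N - (i + 1 + 1)) (by omega) _ ℓ₁ (by
          rw [show N - (i + 1 + 1) + 1 = N - (i + 1) by omega]
          exact ih' (by omega) _)
        refine hx.mono (expENN_le ?_)
        have h4 : 0 ≤ 10 * h * ((i : ℝ) + 1) * (1 - θ) :=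
          mul_nonneg (by positivity) (by linarith)
        push_cast
        have h5 : p * κ * h * θ ^ (i + 1 + 1) * 2 ^ (N - 1)
          = p * κ * h * θ ^ (i + 1) * 2 ^ (N - 1) * θ := by ring
        nlinarith
    have bil : BilBound p δ (L 0) (L 0) (L 0)
        (expENN (p * Φ - p * κ * h * θ ^ N * 2 ^ (N - 1) + 10 * h * N)) := by
      have hx := down (N - 1) (by omega) (L 0)
      rw [show N - 1 + 1 = N by omega, Nat.sub_self] at hx
      have hcast : (((N - 1 : ℕ) : ℝ) + 1) = N := by exact_mod_cast Nat.sub_add_cancel hN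
      rw [hcast] at hx
      rwa [hL0] at hx ⊢
    have he : 1 ≤ Real.exp h := Real.one_le_exp (by linarith)
    set B : ℕ := ⌈Real.exp h⌉₊ + 2 with hB
    have hB1 : ℓ / L 0 + 2 ≤ B := by
      rw [hL0, Real.exp_neg, hB]
      push_cast
      have h4 : ℓ / (ℓ * (Real.exp h)⁻¹) = Real.exp h := by field_simp
      rw [h4]
      linarith [Nat.le_ceil (Real.exp h)]
    have hB2 : (B : ℝ) ≤ 4 * Real.exp h := by
      rw [hB]
      push_cast
      linarith [Nat.ceil_lt_add_one (Real.exp_pos h).le]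
    have hB3 : (B : ℝ≥0∞) ≤ expENN (3 * h) := by
      refine natCast_le_expENN (hB2.trans ?_)
      have h4 := exp_nat_le 2
      push_cast at h4
      have h5 : Real.exp 2 ≤ Real.exp (2 * h) := Real.exp_le_exp.2 (by linarith)
      rw [show 3 * h = 2 * h + h by ring, Real.exp_add]
      nlinarith
    have hfour : (4 : ℝ≥0∞) ^ p ≤ expENN (3 / 2 * p) := by
      rw [mul_comm, mul_comm p, ← expENN_rpow]
      refine ENNReal.rpow_le_rpow ?_ hp0.le
      have h4 : ((4 : ℕ) : ℝ≥0∞) ≤ expENN (3 / 2) := by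
        refine natCast_le_expENN ?_
        have h5 := exp_nat_le 3
        have h6 : Real.exp (3 / 2) ^ 2 = Real.exp (3 : ℕ) := by
          rw [← Real.exp_nat_mul]
          norm_num
        push_cast at *
        nlinarith [Real.exp_pos (3 / 2)]
      exact_mod_cast h4
    refine (DecBound.of_bilBound hp (hδ.trans_le (hLδ 0 (Nat.zero_le _))) hℓ0.le hB1
      (hDL 0 (Nat.zero_le _)) bil).mono ?_
    refine le_trans (add_le_add ?_ ?_) (expENN_half_add_half _)
    · refine (mul_le_mul_left hfour _).trans ?_
      rw [← expENN_add]
      refine expENN_le ?_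
      rw [pow_zero, mul_one]
      nlinarith
    · refine (mul_le_mul_left (ENNReal.rpow_le_rpow hB3 (by linarith)) _).trans ?_
      rw [expENN_rpow, ← expENN_add]
      refine expENN_le ?_
      have h4 : (2 : ℝ) ^ N = 2 * 2 ^ (N - 1) := by
        rw [← pow_succ', Nat.sub_add_cancel hN]
      rw [h4] at hbroad
      have h5 : 0 ≤ κ * θ ^ N * 2 ^ (N - 1) := by positivity
      have h6 : h * (34 + 10 * (N : ℝ)) ≤ h * (p * (κ * θ ^ N * 2 ^ (N - 1))) := by
        refine mul_le_mul_of_nonneg_left ?_ (by linarith)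
        nlinarith
      nlinarith

lemma exists_decBound_parameters {p X : ℝ} (hp : 4 < p) (hp6 : p < 6) (hX : 1 ≤ X) :
    ∃ (h κ : ℝ) (N : ℕ), 1 ≤ N ∧ 1 ≤ h ∧ 2 ≤ κ * h ∧
      34 + 10 * (N : ℝ) ≤ 2 * κ * (2 / (p - 2)) ^ N * 2 ^ N ∧
      2 + h * 2 ^ N + κ * X ≤
        26 * (X ^ ((3 : ℝ) / 4 + (1 / 4) * Real.logb 2 ((p - 2) / 2)) * (1 + Real.log X)) := by
  set s := Real.logb 2 ((p - 2) / 2) with hs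
  have ha : 0 < (p - 2) / 2 := by linarith
  have hs0 : 0 < s := Real.logb_pos (by norm_num) (by linarith)
  have hs1 : s < 1 := by
    rw [hs, Real.logb_lt_iff_lt_rpow (by norm_num) ha, Real.rpow_one]
    linarith
  have htwo : (2 : ℝ) ^ s = (p - 2) / 2 := Real.rpow_logb (by norm_num) (by norm_num) ha
  have hθ : 2 / (p - 2) = (2 : ℝ) ^ (-s) := by
    rw [Real.rpow_neg (by norm_num), htwo, inv_div]
  have hX0 : 0 < X := by linarith
  have hlog : 0 ≤ Real.log X := Real.log_nonneg hX
  have hl2 : 0.69 < Real.log 2 := by linarith [Real.log_two_gt_d9]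
  set N : ℕ := ⌊Real.log X / (2 * Real.log 2)⌋₊ + 1 with hN
  have hN1 : (N : ℝ) ≤ 1 + Real.log X / (2 * Real.log 2) := by
    rw [hN]
    push_cast
    linarith [Nat.floor_le (by positivity : 0 ≤ Real.log X / (2 * Real.log 2))]
  have hN2 : Real.log X / (2 * Real.log 2) ≤ N := by
    rw [hN]
    push_cast
    exact (Nat.lt_floor_add_one _).le
  have hN3 : (N : ℝ) ≤ 1 + Real.log X := by
    refine hN1.trans ?_
    have : Real.log X / (2 * Real.log 2) ≤ Real.log X := div_le_self hlog (by linarith)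
    linarith
  have hpow : (2 : ℝ) ^ (Real.log X / (2 * Real.log 2)) = X ^ (1 / 2 : ℝ) := by
    rw [Real.rpow_def_of_pos (by norm_num), Real.rpow_def_of_pos hX0]
    congr 1
    field_simp
  have hpow1 : X ^ (1 / 2 : ℝ) ≤ 2 ^ N := by
    rw [← hpow, ← Real.rpow_natCast]
    exact Real.rpow_le_rpow_of_exponent_le (by norm_num) hN2
  have hpow2 : (2 : ℝ) ^ N ≤ 2 * X ^ (1 / 2 : ℝ) := by
    rw [← hpow, ← Real.rpow_natCast]
    calc (2 : ℝ) ^ (N : ℝ) ≤ 2 ^ (1 + Real.log X / (2 * Real.log 2)) :=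
          Real.rpow_le_rpow_of_exponent_le (by norm_num) hN1
      _ = _ := by rw [Real.rpow_add (by norm_num), Real.rpow_one]
  have hu : 1 ≤ X ^ ((1 - s) / 4) := Real.one_le_rpow hX (by linarith)
  refine ⟨X ^ ((1 - s) / 4), 22 * X ^ (-((1 - s) / 4)) * (1 + Real.log X), N, by omega, hu,
    ?_, ?_, ?_⟩
  · have : X ^ (-((1 - s) / 4)) * X ^ ((1 - s) / 4) = 1 := by
      rw [← Real.rpow_add hX0, neg_add_cancel, Real.rpow_zero]
    calc (2 : ℝ) ≤ 22 * (1 + Real.log X) := by linarith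
      _ = 22 * (X ^ (-((1 - s) / 4)) * X ^ ((1 - s) / 4)) * (1 + Real.log X) := by
          rw [this, mul_one]
      _ = _ := by ring
  · have h1 : X ^ ((1 - s) / 2) ≤ (2 / (p - 2)) ^ N * 2 ^ N := by
      rw [← mul_pow, hθ]
      rw [← Real.rpow_add_one (by norm_num), ← Real.rpow_natCast, ← Real.rpow_mul (by norm_num),
        mul_comm, Real.rpow_mul (by norm_num), Real.rpow_natCast]
      calc X ^ ((1 - s) / 2) = (X ^ (1 / 2 : ℝ)) ^ (-s + 1) := by
            rw [← Real.rpow_mul hX0.le]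
            congr 1
            ring
        _ ≤ _ := Real.rpow_le_rpow (by positivity) hpow1 (by linarith)
    have h2 : X ^ (-((1 - s) / 4)) * X ^ ((1 - s) / 2) = X ^ ((1 - s) / 4) := by
      rw [← Real.rpow_add hX0]
      congr 1
      ring
    calc 34 + 10 * (N : ℝ) ≤ 44 * (1 + Real.log X) * 1 := by linarith
      _ ≤ 44 * (1 + Real.log X) * X ^ ((1 - s) / 4) :=
          mul_le_mul_of_nonneg_left hu (by positivity)
      _ = 2 * (22 * X ^ (-((1 - s) / 4)) * (1 + Real.log X)) * X ^ ((1 - s) / 2) := by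
          rw [← h2]
          ring
      _ ≤ 2 * (22 * X ^ (-((1 - s) / 4)) * (1 + Real.log X)) * ((2 / (p - 2)) ^ N * 2 ^ N) :=
          mul_le_mul_of_nonneg_left h1 (by positivity)
      _ = _ := by ring
  · set Y := X ^ ((3 : ℝ) / 4 + (1 / 4) * s) with hY
    have hY1 : 1 ≤ Y := Real.one_le_rpow hX (by linarith)
    have h1 : X ^ ((1 - s) / 4) * 2 ^ N ≤ 2 * Y := by
      calc X ^ ((1 - s) / 4) * 2 ^ N ≤ X ^ ((1 - s) / 4) * (2 * X ^ (1 / 2 : ℝ)) :=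
            mul_le_mul_of_nonneg_left hpow2 (by positivity)
        _ = 2 * X ^ ((1 - s) / 4 + 1 / 2) := by
            rw [Real.rpow_add hX0]
            ring
        _ ≤ 2 * Y := mul_le_mul_of_nonneg_left
            (Real.rpow_le_rpow_of_exponent_le hX (by linarith)) (by norm_num)
    have h2 : X ^ (-((1 - s) / 4)) * X = Y := by
      nth_rewrite 2 [← Real.rpow_one X]
      rw [← Real.rpow_add hX0]
      congr 1
      ring
    have h3 : 22 * X ^ (-((1 - s) / 4)) * (1 + Real.log X) * X = 22 * (Y * (1 + Real.log X)) := by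
      rw [← h2]
      ring
    rw [h3]
    nlinarith [mul_nonneg (by linarith : (0 : ℝ) ≤ Y) hlog]

/-- The closed rectangle with half side lengths `a` and `b` centered at the origin. -/
def rect (a b : ℝ) : Set (ℝ × ℝ) := {l | |l.1| ≤ a ∧ |l.2| ≤ b}

lemma integral_exp_mul_I_eq_two_mul_sinc (r : ℝ) :
    ∫ v in Set.Icc (-1 : ℝ) 1, Complex.exp (((r * v : ℝ) : ℂ) * Complex.I) = 2 * Real.sinc r := by
  rw [integral_Icc_eq_integral_Ioc, ← intervalIntegral.integral_of_le (by norm_num)]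
  rcases eq_or_ne r 0 with rfl | hr
  · simp; norm_num
  · rw [intervalIntegral.integral_comp_mul_left
      (fun t : ℝ => Complex.exp ((t : ℂ) * Complex.I)) hr]
    have := integral_exp_mul_I_eq_sinc r
    simp only [mul_neg, mul_one]
    rw [this, Complex.real_smul]
    have hr' : (r : ℂ) ≠ 0 := by exact_mod_cast hr
    push_cast
    field_simp

lemma hasSpec_sinc_fst {a : ℝ} (ha : 0 ≤ a) :
    HasSpec (rect a 0) fun x => 2 * (Real.sinc (2 * Real.pi * a * x.1) : ℂ) := by
  refine ⟨ℝ, inferInstance, volume.restrict (Set.Icc (-1) 1), inferInstance, fun _ => 1,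
    fun v => (a * v, 0), integrable_const _, by fun_prop, ?_, fun x => ?_⟩
  · refine (ae_restrict_mem measurableSet_Icc).mono fun v hv => ⟨?_, by simp⟩
    dsimp only
    rw [abs_mul, abs_of_nonneg ha]
    exact mul_le_of_le_one_right ha (abs_le.2 hv)
  · dsimp only
    rw [← integral_exp_mul_I_eq_two_mul_sinc]
    refine integral_congr_ae (Filter.Eventually.of_forall fun v => ?_)
    simp only [planeChar, one_mul]
    congr 1
    push_cast
    ring

lemma hasSpec_sinc_snd {a : ℝ} (ha : 0 ≤ a) :
    HasSpec (rect 0 a) fun x => 2 * (Real.sinc (2 * Real.pi * a * x.2) : ℂ) := by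
  refine ⟨ℝ, inferInstance, volume.restrict (Set.Icc (-1) 1), inferInstance, fun _ => 1,
    fun v => (0, a * v), integrable_const _, by fun_prop, ?_, fun x => ?_⟩
  · refine (ae_restrict_mem measurableSet_Icc).mono fun v hv => ⟨by simp, ?_⟩
    dsimp only
    rw [abs_mul, abs_of_nonneg ha]
    exact mul_le_of_le_one_right ha (abs_le.2 hv)
  · dsimp only
    rw [← integral_exp_mul_I_eq_two_mul_sinc]
    refine integral_congr_ae (Filter.Eventually.of_forall fun v => ?_)
    simp only [planeChar, one_mul]
    congr 1
    push_cast
    ring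

lemma HasSpec.mul_rect {a b a' b' : ℝ} {f g : ℝ × ℝ → ℂ} (hf : HasSpec (rect a b) f)
    (hg : HasSpec (rect a' b') g) : HasSpec (rect (a + a') (b + b')) fun x => f x * g x := by
  refine (hf.mul hg).mono ?_
  rintro _ ⟨l, hl, m, hm, rfl⟩
  exact ⟨(abs_add_le _ _).trans (add_le_add hl.1 hm.1),
    (abs_add_le _ _).trans (add_le_add hl.2 hm.2)⟩

lemma HasSpec.pow_rect {a b : ℝ} {f : ℝ × ℝ → ℂ} (hf : HasSpec (rect a b) f) (m : ℕ) :
    HasSpec (rect ((m + 1 : ℕ) * a) ((m + 1 : ℕ) * b)) fun x => f x ^ (m + 1) := by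
  induction m with
  | zero => simpa using hf
  | succ m ih =>
    simp only [pow_succ _ (m + 1)]
    refine (ih.mul_rect hf).mono ?_
    rintro l ⟨h1, h2⟩
    push_cast at h1 h2 ⊢
    exact ⟨h1.trans (by linarith), h2.trans (by linarith)⟩

/-- A band-limited function adapted to the square of side length `R` centered at the origin. -/
noncomputable def bump (R : ℝ) (x : ℝ × ℝ) : ℂ :=
  (2 * (Real.sinc (2 * Real.pi * (1 / (52 * R)) * x.1) : ℂ)) ^ 26 *
    (2 * (Real.sinc (2 * Real.pi * (1 / (52 * R)) * x.2) : ℂ)) ^ 26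

lemma hasSpec_bump {R : ℝ} (hR : 0 < R) : HasSpec (rect (1 / (2 * R)) (1 / (2 * R))) (bump R) := by
  have ha : 0 ≤ 1 / (52 * R) := by positivity
  refine (((hasSpec_sinc_fst ha).pow_rect 25).mul_rect ((hasSpec_sinc_snd ha).pow_rect 25)).mono ?_
  rintro l ⟨h1, h2⟩
  have e : 26 * (1 / (52 * R)) = 1 / (2 * R) := by field_simp; norm_num
  push_cast at h1 h2
  norm_num only at h1 h2
  constructor
  · rw [← e]; linarith
  · rw [← e]; linarith

lemma one_le_two_mul_sinc {y : ℝ} (hy : |y| ≤ 1 / 2) : 1 ≤ 2 * |Real.sinc y| := by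
  rcases eq_or_ne y 0 with rfl | h
  · simp
  · have h1 : |y| - |y| ^ 3 / 6 < Real.sin |y| := Real.sin_gt_sub_cube (abs_pos.2 h)
    have h0 := abs_pos.2 h
    have h2 : |y| ^ 3 ≤ |y| := by
      nlinarith [mul_nonneg h0.le (by nlinarith : 0 ≤ 1 - |y| ^ 2)]
    have h3 : Real.sin |y| ≤ |Real.sin y| := by
      rcases abs_cases y with ⟨e, -⟩ | ⟨e, -⟩ <;> rw [e]
      · exact le_abs_self _
      · rw [Real.sin_neg]; exact neg_le_abs _
    rw [Real.sinc_of_ne_zero h, abs_div, ← mul_div_assoc, le_div_iff₀ h0]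
    nlinarith

lemma norm_two_mul_sinc (y : ℝ) : ‖2 * (Real.sinc y : ℂ)‖ = 2 * |Real.sinc y| := by
  rw [norm_mul, Complex.norm_real, Complex.norm_ofNat, Real.norm_eq_abs]

lemma two_mul_abs_sinc_le {R : ℝ} (hR : 0 < R) (v : ℝ) :
    2 * |Real.sinc (2 * Real.pi * (1 / (52 * R)) * v)| ≤ 54 / (1 + |v| / R) := by
  set y := 2 * Real.pi * (1 / (52 * R)) * v with hy
  have h1 : |y| * |Real.sinc y| ≤ 1 := by
    rcases eq_or_ne y 0 with h | h
    · simp [h]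
    · rw [← abs_mul, Real.sinc_of_ne_zero h, mul_div_cancel₀ _ h]
      exact Real.abs_sin_le_one y
  have h2 : |y| = Real.pi / 26 * (|v| / R) := by
    rw [hy, abs_mul, abs_of_nonneg (by positivity)]
    field_simp
    ring
  have h3 := Real.abs_sinc_le_one y
  have h4 : 0 ≤ |v| / R * |Real.sinc y| := by positivity
  rw [le_div_iff₀ (by positivity)]
  rw [h2] at h1
  nlinarith [Real.pi_gt_three]

lemma one_le_norm_bump {R : ℝ} (hR : 0 < R) {x : ℝ × ℝ} (h1 : |x.1| ≤ R / 2) (h2 : |x.2| ≤ R / 2) :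
    1 ≤ ‖bump R x‖ := by
  have key : ∀ v : ℝ, |v| ≤ R / 2 →
      1 ≤ ‖2 * (Real.sinc (2 * Real.pi * (1 / (52 * R)) * v) : ℂ)‖ := by
    intro v hv
    rw [norm_two_mul_sinc]
    apply one_le_two_mul_sinc
    rw [abs_mul, abs_of_nonneg (by positivity)]
    calc 2 * Real.pi * (1 / (52 * R)) * |v| ≤ 2 * Real.pi * (1 / (52 * R)) * (R / 2) := by gcongr
      _ = Real.pi / 52 := by field_simp
      _ ≤ 1 / 2 := by linarith [Real.pi_lt_four]
  rw [bump, norm_mul, norm_pow, norm_pow]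
  exact one_le_mul_of_one_le_of_one_le (one_le_pow₀ (key _ h1)) (one_le_pow₀ (key _ h2))

lemma norm_bump_le {R : ℝ} (hR : 0 < R) (x : ℝ × ℝ) :
    ‖bump R x‖ ≤ 54 ^ 52 * (1 + Real.sqrt (x.1 ^ 2 + x.2 ^ 2) / R) ^ (-26 : ℤ) := by
  have hs : Real.sqrt (x.1 ^ 2 + x.2 ^ 2) ≤ |x.1| + |x.2| := by
    rw [Real.sqrt_le_left (by positivity)]
    nlinarith [sq_abs x.1, sq_abs x.2, abs_nonneg x.1, abs_nonneg x.2,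
      mul_nonneg (abs_nonneg x.1) (abs_nonneg x.2)]
  have hs' : 1 + Real.sqrt (x.1 ^ 2 + x.2 ^ 2) / R ≤ (1 + |x.1| / R) * (1 + |x.2| / R) := by
    have : Real.sqrt (x.1 ^ 2 + x.2 ^ 2) / R ≤ |x.1| / R + |x.2| / R := by
      rw [← add_div]; gcongr
    have h3 : 0 ≤ |x.1| / R * (|x.2| / R) := by positivity
    nlinarith
  rw [bump, norm_mul, norm_pow, norm_pow, norm_two_mul_sinc, norm_two_mul_sinc, zpow_neg,
    ← div_eq_mul_inv]
  calc _ ≤ (54 / (1 + |x.1| / R)) ^ 26 * (54 / (1 + |x.2| / R)) ^ 26 := by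
        gcongr <;> exact two_mul_abs_sinc_le hR _
    _ = 54 ^ 52 / ((1 + |x.1| / R) * (1 + |x.2| / R)) ^ 26 := by
        rw [div_pow, div_pow, div_mul_div_comm, ← pow_add, mul_pow]
    _ ≤ _ := by
        have : (0:ℝ) < 1 + Real.sqrt (x.1 ^ 2 + x.2 ^ 2) / R := by positivity
        rw [show ((26:ℤ)) = ((26:ℕ):ℤ) by norm_num, zpow_natCast]
        gcongr

lemma hasSpec_extOp {a b : ℝ} {g : ℝ → ℂ} (hg : IntegrableOn g (Set.Icc a b)) :
    HasSpec {l | l.1 ∈ Set.Icc a b ∧ l.2 = l.1 ^ 2} (extOp a b g) := by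
  refine ⟨ℝ, inferInstance, volume.restrict (Set.Icc a b), inferInstance, g,
    fun ξ => (ξ, ξ ^ 2), hg, by fun_prop, ?_, fun x => rfl⟩
  exact (ae_restrict_mem measurableSet_Icc).mono fun ξ hξ => ⟨hξ, rfl⟩

lemma sum_extOp {n : ℕ} (hn : 0 < n) {g : ℝ → ℂ} (hg : IntegrableOn g (Set.Icc 0 1))
    (x : ℝ × ℝ) :
    ∑ k ∈ Finset.range n, extOp ((k : ℝ) / n) (((k : ℝ) + 1) / n) g x = extOp 0 1 g x := by
  have hn' : (0 : ℝ) < n := by exact_mod_cast hn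
  set F : ℝ → ℂ := fun ξ => g ξ * planeChar (ξ, ξ ^ 2) x with hF
  have hFi : IntegrableOn F (Set.Icc 0 1) :=
    integrable_mul_planeChar (l := fun ξ : ℝ => (ξ, ξ ^ 2)) hg (by fun_prop) x
  have conv : ∀ a b : ℝ, a ≤ b → extOp a b g x = ∫ ξ in a..b, F ξ := by
    intro a b hab
    rw [intervalIntegral.integral_of_le hab, ← integral_Icc_eq_integral_Ioc]
    rfl
  have hk : ∀ k : ℕ, (k : ℝ) / n ≤ ((k + 1 : ℕ) : ℝ) / n := fun k => by gcongr; simp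
  have h := intervalIntegral.sum_integral_adjacent_intervals (f := F) (μ := volume)
    (a := fun k : ℕ => (k : ℝ) / n) (n := n) ?_
  · rw [conv 0 1 zero_le_one]
    simp only [Nat.cast_zero, zero_div, div_self hn'.ne'] at h
    rw [← h]
    refine Finset.sum_congr rfl fun k _ => ?_
    have := conv _ _ (hk k)
    push_cast at this ⊢
    exact this
  · intro k hkn
    rw [intervalIntegrable_iff_integrableOn_Icc_of_le (hk k)]
    refine hFi.mono_set (Set.Icc_subset_Icc (by positivity) ?_)
    rw [div_le_one hn']
    exact_mod_cast hkn

lemma isParFamily_extOp_mul_bump {n : ℕ} (hn : 0 < n) {g : ℝ → ℂ}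
    (hg : IntegrableOn g (Set.Icc 0 1)) (c : ℝ × ℝ) :
    IsParFamily (1 / n) (Finset.range n) (fun k => (k : ℝ) / n)
      fun k x => extOp ((k : ℝ) / n) (((k : ℝ) + 1) / n) g x * bump ((n : ℝ) ^ 2) (x - c) := by
  have hn' : (0 : ℝ) < n := by exact_mod_cast hn
  refine ⟨fun k hk => ?_, fun i hi j hj hij => ?_⟩
  · have hkn : ((k : ℝ) + 1) / n ≤ 1 := by
      rw [div_le_one hn']; exact_mod_cast Finset.mem_range.1 hk
    have hb : HasSpec (rect (1 / (2 * (n : ℝ) ^ 2)) (1 / (2 * (n : ℝ) ^ 2)))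
        fun x => bump ((n : ℝ) ^ 2) (x - c) := by
      simpa only [sub_eq_add_neg] using
        (hasSpec_bump (R := (n : ℝ) ^ 2) (by positivity)).translate (-c)
    refine ((hasSpec_extOp (hg.mono_set (Set.Icc_subset_Icc (by positivity) hkn))).mul hb).mono ?_
    rintro _ ⟨l, ⟨⟨h1, h2⟩, h3⟩, m, ⟨h4, h5⟩, rfl⟩
    have e : 1 / (2 * (n : ℝ) ^ 2) = (1 / n) ^ 2 / 2 := by field_simp
    rw [e] at h4 h5
    rw [add_div] at h2 hkn
    have h0 : (0 : ℝ) ≤ k / n := by positivity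
    set δ : ℝ := 1 / n
    set t : ℝ := k / n
    have hδ : 0 < δ := by positivity
    have hδ1 : δ ≤ 1 := by linarith
    have hδ2 : δ ^ 2 ≤ δ := by nlinarith
    rw [abs_le] at h4 h5
    constructor
    · simp only [Prod.fst_add]
      rw [abs_le]
      constructor <;> linarith
    · simp only [Prod.fst_add, Prod.snd_add]
      rw [h3, abs_le]
      have h6 : (l.1 - t) ^ 2 ≤ δ ^ 2 := by
        apply pow_le_pow_left₀ <;> linarith
      have h7 : |2 * t * m.1| ≤ δ ^ 2 := by
        rw [abs_mul, abs_of_nonneg (by positivity)]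
        have : |m.1| ≤ δ ^ 2 / 2 := abs_le.2 h4
        nlinarith [abs_nonneg m.1]
      rw [abs_le] at h7
      constructor <;> nlinarith [sq_nonneg (l.1 - t)]
  · rw [← sub_div, abs_div, abs_of_pos hn']
    gcongr
    have : (1 : ℤ) ≤ |(i : ℤ) - j| := Int.one_le_abs (by omega)
    exact_mod_cast this

lemma wB_nonneg (c : ℝ × ℝ) {R : ℝ} (hR : 0 < R) (x : ℝ × ℝ) : 0 ≤ wB c R x := by
  unfold wB; positivity

lemma continuous_wB (c : ℝ × ℝ) {R : ℝ} (hR : 0 < R) : Continuous (wB c R) := by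
  unfold wB
  refine Continuous.zpow₀ (by fun_prop) _ fun x => Or.inl ?_
  positivity

lemma norm_le_sqrt (x : ℝ × ℝ) : ‖x‖ ≤ Real.sqrt (x.1 ^ 2 + x.2 ^ 2) := by
  rw [Prod.norm_def]
  refine max_le ?_ ?_ <;> refine Real.le_sqrt_of_sq_le ?_ <;> rw [Real.norm_eq_abs, sq_abs]
  · linarith [sq_nonneg x.2]
  · linarith [sq_nonneg x.1]

lemma integrable_wB (c : ℝ × ℝ) {R : ℝ} (hR : 1 ≤ R) : Integrable (wB c R) := by
  have hR0 : 0 < R := by linarith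
  have h1 : Integrable fun x : ℝ × ℝ => (1 + ‖x‖) ^ (-100 : ℝ) := by
    refine integrable_one_add_norm ?_
    rw [Module.finrank_prod]; norm_num
  refine ((h1.comp_sub_right c).const_mul (R ^ 100)).mono'
    (continuous_wB c hR0).aestronglyMeasurable (Filter.Eventually.of_forall fun x => ?_)
  rw [Real.norm_eq_abs, abs_of_nonneg (wB_nonneg c hR0 x)]
  have h2 := norm_le_sqrt (x - c)
  simp only [Prod.fst_sub, Prod.snd_sub] at h2
  have h3 : (1 + ‖x - c‖) / R ≤ 1 + Real.sqrt ((x.1 - c.1) ^ 2 + (x.2 - c.2) ^ 2) / R := by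
    rw [add_div]
    gcongr
    rwa [div_le_one hR0]
  have h4 : 0 < (1 + ‖x - c‖) / R := by positivity
  rw [wB, show (-100 : ℝ) = -((100 : ℕ) : ℝ) by norm_num, Real.rpow_neg (by positivity),
    Real.rpow_natCast, show (-100 : ℤ) = -((100 : ℕ) : ℤ) by norm_num, zpow_neg, zpow_natCast]
  calc _ ≤ (((1 + ‖x - c‖) / R) ^ 100)⁻¹ := by gcongr
    _ = _ := by rw [div_pow, inv_div, div_eq_mul_inv]

lemma norm_bump_rpow_le {p : ℝ} (hp : 4 < p) {R : ℝ} (hR : 0 < R) (c x : ℝ × ℝ) :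
    ‖bump R (x - c)‖ ^ p ≤ (54 ^ 52) ^ p * wB c R x := by
  have h := norm_bump_le hR (x - c)
  simp only [Prod.fst_sub, Prod.snd_sub] at h
  set A := 1 + Real.sqrt ((x.1 - c.1) ^ 2 + (x.2 - c.2) ^ 2) / R with hA
  have hA1 : 1 ≤ A := le_add_of_nonneg_right (by positivity)
  have hA0 : 0 < A := by linarith
  calc ‖bump R (x - c)‖ ^ p ≤ (54 ^ 52 * A ^ (-26 : ℤ)) ^ p := by gcongr
    _ = (54 ^ 52) ^ p * (A ^ (-26 : ℤ)) ^ p := Real.mul_rpow (by positivity) (by positivity)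
    _ ≤ (54 ^ 52) ^ p * wB c R x := by
      rw [wB, ← hA, ← Real.rpow_intCast, ← Real.rpow_intCast, ← Real.rpow_mul hA0.le]
      gcongr
      push_cast
      linarith

lemma integrable_norm_rpow_mul_wB {p : ℝ} (hp : 0 ≤ p) (c : ℝ × ℝ) {R : ℝ} (hR : 1 ≤ R)
    {f : ℝ × ℝ → ℂ} {S : Set (ℝ × ℝ)} (hf : HasSpec S f) :
    Integrable fun x => ‖f x‖ ^ p * wB c R x := by
  obtain ⟨M, hM⟩ := hf.bounded
  refine (integrable_wB c hR).bdd_mul (c := M ^ p) ?_ (Filter.Eventually.of_forall fun x => ?_)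
  · exact (hf.continuous.norm.rpow_const fun _ => Or.inr hp).aestronglyMeasurable
  · rw [Real.norm_eq_abs, abs_of_nonneg (by positivity)]
    exact Real.rpow_le_rpow (norm_nonneg _) (hM x) hp

lemma enorm_rpow_eq_ofReal {p : ℝ} (hp : 0 ≤ p) (z : ℂ) : ‖z‖ₑ ^ p = ENNReal.ofReal (‖z‖ ^ p) := by
  rw [← ofReal_norm, ENNReal.ofReal_rpow_of_nonneg (norm_nonneg _) hp]

lemma sqMass_mul_bump_le {p : ℝ} (hp : 4 < p) (c : ℝ × ℝ) {R : ℝ} (hR : 1 ≤ R)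
    {f : ℝ × ℝ → ℂ} {S : Set (ℝ × ℝ)} (hf : HasSpec S f) :
    sqMass p (fun x => f x * bump R (x - c)) ≤
      ENNReal.ofReal ((54 ^ 52) ^ 2 * wLp p (wB c R) f ^ 2) := by
  have hp0 : 0 < p := by linarith
  have hR0 : 0 < R := by linarith
  have hI : 0 ≤ ∫ x, ‖f x‖ ^ p * wB c R x :=
    integral_nonneg fun x => mul_nonneg (by positivity) (wB_nonneg c hR0 x)
  have h1 : ∫⁻ x, ‖f x * bump R (x - c)‖ₑ ^ p
      ≤ ENNReal.ofReal ((54 ^ 52) ^ p * ∫ x, ‖f x‖ ^ p * wB c R x) := by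
    rw [← integral_const_mul, ofReal_integral_eq_lintegral_ofReal
      ((integrable_norm_rpow_mul_wB hp0.le c hR hf).const_mul _)
      (Filter.Eventually.of_forall fun x => by have := wB_nonneg c hR0 x; dsimp; positivity)]
    refine lintegral_mono fun x => ?_
    dsimp only
    rw [enorm_rpow_eq_ofReal hp0.le, norm_mul, Real.mul_rpow (norm_nonneg _) (norm_nonneg _)]
    refine ENNReal.ofReal_le_ofReal ?_
    calc _ ≤ ‖f x‖ ^ p * ((54 ^ 52) ^ p * wB c R x) := by
          gcongr; exact norm_bump_rpow_le hp hR0 c x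
      _ = _ := by ring
  unfold sqMass
  refine (ENNReal.rpow_le_rpow h1 (by positivity)).trans_eq ?_
  rw [ENNReal.ofReal_rpow_of_nonneg (by positivity) (by positivity), wLp,
    Real.mul_rpow (by positivity) hI, ← Real.rpow_mul (by positivity), ← Real.rpow_mul_natCast hI]
  rw [mul_div_cancel₀ _ hp0.ne', Real.rpow_two,
    show 1 / p * ((2 : ℕ) : ℝ) = 2 / p by push_cast; ring]

lemma sqLp_le_of_lintegral_le {p : ℝ} (hp : 0 < p) {f : ℝ × ℝ → ℂ} (hf : Continuous f)
    (c : ℝ × ℝ) (R : ℝ) {A : ℝ} (hA : 0 ≤ A)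
    (h : ∫⁻ x in sqr c R, ‖f x‖ₑ ^ p ≤ ENNReal.ofReal (A ^ p)) : sqLp p c R f ≤ A := by
  have hm : AEStronglyMeasurable (fun x => ‖f x‖ ^ p) (volume.restrict (sqr c R)) :=
    (hf.norm.rpow_const fun _ => Or.inr hp.le).aestronglyMeasurable
  have h0 : 0 ≤ ∫ x in sqr c R, ‖f x‖ ^ p := integral_nonneg fun x => by positivity
  have h1 : ∫ x in sqr c R, ‖f x‖ ^ p ≤ A ^ p := by
    rw [integral_eq_lintegral_of_nonneg_ae (Filter.Eventually.of_forall fun x => by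
      dsimp; positivity) hm]
    refine ENNReal.toReal_le_of_le_ofReal (by positivity) ?_
    simpa only [enorm_rpow_eq_ofReal hp.le] using h
  rw [sqLp]
  calc _ ≤ (A ^ p) ^ (1 / p) := Real.rpow_le_rpow h0 h1 (by positivity)
    _ = A := by rw [← Real.rpow_mul hA, mul_one_div_cancel hp.ne', Real.rpow_one]

lemma decIneq_of_decBound {p : ℝ} (hp : 4 < p) {n : ℕ} (hn : 0 < n) {L : ℝ}
    (h : DecBound p (1 / n) 1 (expENN (p * L))) : DecIneq p n (54 ^ 52 * Real.exp L) := by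
  intro g hg c
  have hp0 : 0 < p := by linarith
  have hn1 : (1 : ℝ) ≤ n := by exact_mod_cast hn
  have hR : (1 : ℝ) ≤ (n : ℝ) ^ 2 := one_le_pow₀ hn1
  have hR0 : (0 : ℝ) < (n : ℝ) ^ 2 := by linarith
  set W : ℕ → ℝ := fun k =>
    wLp p (wB c ((n : ℝ) ^ 2)) (extOp ((k : ℝ) / (n : ℝ)) (((k : ℝ) + 1) / (n : ℝ)) g) with hW
  have hS : 0 ≤ ∑ k ∈ Finset.range n, W k ^ 2 := Finset.sum_nonneg fun k _ => sq_nonneg _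
  set S := ∑ k ∈ Finset.range n, W k ^ 2 with hSdef
  have hpiece : ∀ k ∈ Finset.range n,
      sqMass p (fun x => extOp ((k : ℝ) / n) (((k : ℝ) + 1) / n) g x * bump ((n : ℝ) ^ 2) (x - c))
        ≤ ENNReal.ofReal ((54 ^ 52) ^ 2 * W k ^ 2) := by
    intro k hk
    have hkn : ((k : ℝ) + 1) / n ≤ 1 := by
      rw [div_le_one (by linarith)]; exact_mod_cast Finset.mem_range.1 hk
    exact sqMass_mul_bump_le hp c hR
      (hasSpec_extOp (hg.mono_set (Set.Icc_subset_Icc (by positivity) hkn)))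
  refine sqLp_le_of_lintegral_le hp0 (hasSpec_extOp hg).continuous c _ (by positivity) ?_
  calc ∫⁻ x in sqr c ((n : ℝ) ^ 2), ‖extOp 0 1 g x‖ₑ ^ p
      ≤ ∫⁻ x in sqr c ((n : ℝ) ^ 2), ‖∑ k ∈ Finset.range n,
          extOp ((k : ℝ) / n) (((k : ℝ) + 1) / n) g x * bump ((n : ℝ) ^ 2) (x - c)‖ₑ ^ p := by
        refine setLIntegral_mono' (measurableSet_Icc.prod measurableSet_Icc) fun x hx => ?_
        rw [← Finset.sum_mul, sum_extOp hn hg]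
        refine ENNReal.rpow_le_rpow ?_ hp0.le
        have hb : 1 ≤ ‖bump ((n : ℝ) ^ 2) (x - c)‖ := by
          obtain ⟨⟨h1, h2⟩, h3, h4⟩ := hx
          refine one_le_norm_bump hR0 (abs_le.2 ⟨?_, ?_⟩) (abs_le.2 ⟨?_, ?_⟩) <;>
            simp only [Prod.fst_sub, Prod.snd_sub] <;> linarith
        rw [enorm_mul]
        refine le_mul_of_one_le_right' ?_
        rw [← ofReal_norm]
        exact ENNReal.one_le_ofReal.2 hb
    _ ≤ ∫⁻ x, ‖∑ k ∈ Finset.range n,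
          extOp ((k : ℝ) / n) (((k : ℝ) + 1) / n) g x * bump ((n : ℝ) ^ 2) (x - c)‖ₑ ^ p :=
        setLIntegral_le_lintegral _ _
    _ ≤ expENN (p * L) * (∑ k ∈ Finset.range n, sqMass p (fun x =>
          extOp ((k : ℝ) / n) (((k : ℝ) + 1) / n) g x * bump ((n : ℝ) ^ 2) (x - c))) ^ (p / 2) := by
        refine h _ _ _ (isParFamily_extOp_mul_bump hn hg c) fun i hi j hj => ?_
        have key : ∀ k ∈ Finset.range n, (k : ℝ) / n ≤ 1 := fun k hk => by
          rw [div_le_one (by linarith)]; exact_mod_cast (Finset.mem_range.1 hk).le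
        have hi' : (0 : ℝ) ≤ (i : ℝ) / n := by positivity
        have hj' : (0 : ℝ) ≤ (j : ℝ) / n := by positivity
        rw [abs_le]
        constructor <;> linarith [key i hi, key j hj]
    _ ≤ expENN (p * L) * (ENNReal.ofReal ((54 ^ 52) ^ 2 * S)) ^ (p / 2) := by
        gcongr
        rw [hSdef, Finset.mul_sum, ENNReal.ofReal_sum_of_nonneg fun k _ => by positivity]
        exact Finset.sum_le_sum hpiece
    _ = ENNReal.ofReal ((54 ^ 52 * Real.exp L * S ^ (1 / 2 : ℝ)) ^ p) := by
        rw [expENN, ENNReal.ofReal_rpow_of_nonneg (by positivity) (by positivity),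
          ← ENNReal.ofReal_mul (Real.exp_nonneg _), Real.mul_rpow (by positivity) (by positivity),
          Real.mul_rpow (by positivity) (by positivity),
          Real.mul_rpow (by positivity) (by positivity),
          ← Real.exp_mul, ← Real.rpow_mul hS, ← Real.rpow_natCast ((54 : ℝ) ^ 52) 2,
          ← Real.rpow_mul (by positivity), mul_comm L p,
          show ((2 : ℕ) : ℝ) * (p / 2) = p by push_cast; ring,
          show 1 / 2 * p = p / 2 by ring]
        congr 1
        ring

lemma Dconst_le {p : ℝ} {n : ℕ} {D : ℝ} (hD : 0 ≤ D) (h : DecIneq p n D) : Dconst p n ≤ D :=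
  csInf_le ⟨0, fun _ hx => hx.1⟩ ⟨hD, h⟩

end

/-- effective `l²L^p` decoupling for the parabola, `4 < p < 6`. -/
theorem effective_decoupling_parabola :
    ∃ C : ℝ, 0 < C ∧ ∀ p : ℝ, 4 < p → p < 6 → ∀ n : ℕ, 3 ≤ n →
      Dconst p n ≤
        Real.exp (C * Real.log n ^ ((3 : ℝ) / 4 + (1 / 4) * Real.logb 2 ((p - 2) / 2)) *
          Real.log (Real.log n)) := by
  have hl3 : 1 < Real.log 3 := by
    rw [Real.lt_log_iff_exp_lt (by norm_num)]; exact Real.exp_one_lt_three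
  set b := Real.log (Real.log 3) with hb
  have hb0 : 0 < b := Real.log_pos hl3
  have h54 : 0 < Real.log 54 := Real.log_pos (by norm_num)
  refine ⟨26 + (26 + 52 * Real.log 54) / b, by positivity, fun p hp hp6 n hn => ?_⟩
  have hn3 : (3 : ℝ) ≤ n := by exact_mod_cast hn
  have hX3 : Real.log 3 ≤ Real.log n := Real.log_le_log (by norm_num) hn3
  have hX : 1 ≤ Real.log n := by linarith
  obtain ⟨h, κ, N, hN, hh, hκ, hbroad, hle⟩ := exists_decBound_parameters hp hp6 hX
  have hδ : (0 : ℝ) < 1 / n := by positivity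
  have hδ1 : 1 / (n : ℝ) ≤ 1 := by rw [div_le_one (by linarith)]; linarith
  have hdec := decBound_exp hp hp6 hδ hN hh hκ hbroad hδ1
  rw [one_div_one_div] at hdec
  refine (Dconst_le (by positivity) (decIneq_of_decBound hp (by omega) hdec)).trans ?_
  have hτ : 0 ≤ (3 : ℝ) / 4 + (1 / 4) * Real.logb 2 ((p - 2) / 2) := by
    have : 0 ≤ Real.logb 2 ((p - 2) / 2) := Real.logb_nonneg (by norm_num) (by linarith)
    positivity
  set Y := Real.log n ^ ((3 : ℝ) / 4 + (1 / 4) * Real.logb 2 ((p - 2) / 2)) with hY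
  have hY1 : 1 ≤ Y := Real.one_le_rpow hX hτ
  have hLX : b ≤ Real.log (Real.log n) := Real.log_le_log (by linarith) hX3
  set M := Real.log (Real.log n)
  have hM : 1 ≤ M / b := by rwa [one_le_div hb0]
  rw [show (54 : ℝ) ^ 52 = Real.exp (52 * Real.log 54) by
    rw [mul_comm, Real.exp_mul, Real.exp_log (by norm_num)]; norm_cast, ← Real.exp_add]
  refine Real.exp_le_exp.2 ?_
  have hYM : 1 ≤ Y * (M / b) := one_le_mul_of_one_le_of_one_le hY1 hM
  have hYM' : Y ≤ Y * (M / b) := le_mul_of_one_le_right (by linarith) hM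
  calc _ ≤ 52 * Real.log 54 * (Y * (M / b)) + (26 * (Y * (M / b)) + 26 * (Y * M)) := by
        have : 52 * Real.log 54 ≤ 52 * Real.log 54 * (Y * (M / b)) :=
          le_mul_of_one_le_right (by positivity) hYM
        linarith
    _ = _ := by ring
end

section
/- There is an absolute constant c such that for every K ≥ 1 the following holds: if B is an axis-parallel square of side length R, 0 < R' < R, and ℬ is a finite collection of axis-parallel squares of side length R' satisfying Σ_{Δ ∈ ℬ} 1_Δ(x) ≤ K · 1_B(x) for every x ∈ ℝ² (a K-fold overlapping cover of B), then Σ_{Δ ∈ ℬ} w_Δ(x) ≤ c · K · w_B(x) for every x ∈ ℝ²; the same inequality holds with the weights w replaced by the product weights w̃ throughout. -/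
open MeasureTheory

/-- The decay factor at distance `t` from a square of side `r` inside one of side `R`. -/
noncomputable def decayFactor (R r t : ℝ) : ℝ := max (1 + t / r)⁻¹ (r / R)

section DecayFactor

variable {R r t t' T : ℝ}

theorem decayFactor_nonneg (hr : 0 < r) (hR : r < R) : 0 ≤ decayFactor R r t :=
  le_max_of_le_right (div_nonneg hr.le (hr.trans hR).le)

theorem decayFactor_le_one (hr : 0 < r) (hR : r < R) (ht : 0 ≤ t) : decayFactor R r t ≤ 1 := by
  refine max_le (inv_le_one_of_one_le₀ ?_) ((div_le_one (hr.trans hR)).2 hR.le)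
  linarith [div_nonneg ht hr.le]

theorem decayFactor_anti (hr : 0 < r) (ht : 0 ≤ t) (h : t ≤ t') :
    decayFactor R r t' ≤ decayFactor R r t := by
  unfold decayFactor
  gcongr

theorem one_add_div_le_decayFactor (hr : 0 < r) (hR : r < R) (ht : 0 ≤ t) (hT : T ≤ t + R) :
    1 + T / R ≤ 3 * decayFactor R r t * (1 + t / r) := by
  have hR0 : 0 < R := hr.trans hR
  have hu : 0 < 1 + t / r := by positivity
  have h1 : 1 ≤ decayFactor R r t * (1 + t / r) := by
    exact (inv_le_iff_one_le_mul₀ hu).1 (le_max_left _ _)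
  have h2 : t / R ≤ decayFactor R r t * (1 + t / r) := by
    calc t / R = r / R * (t / r) := by field_simp
      _ ≤ r / R * (1 + t / r) := by gcongr; linarith
      _ ≤ _ := mul_le_mul_of_nonneg_right (le_max_right _ _) hu.le
  have h3 : T / R ≤ t / R + 1 := by
    calc T / R ≤ (t + R) / R := by gcongr
      _ = t / R + 1 := by field_simp
  linarith

theorem one_add_div_zpow_le (hr : 0 < r) (hR : r < R) (ht : 0 ≤ t) (hT0 : 0 ≤ T)
    (hT : T ≤ t + R) :
    (1 + t / r) ^ (-100 : ℤ) ≤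
      3 ^ 100 * (1 + T / R) ^ (-100 : ℤ) * decayFactor R r t ^ 100 := by
  have hR0 : 0 < R := hr.trans hR
  have hu : 0 < 1 + t / r := by positivity
  have hv : 0 < 1 + T / R := by positivity
  have key : (1 + t / r)⁻¹ ≤ 3 * (1 + T / R)⁻¹ * decayFactor R r t := by
    rw [inv_le_iff_one_le_mul₀ hu]
    calc 1 = (1 + T / R)⁻¹ * (1 + T / R) := (inv_mul_cancel₀ hv.ne').symm
      _ ≤ (1 + T / R)⁻¹ * (3 * decayFactor R r t * (1 + t / r)) := by
        gcongr; exact one_add_div_le_decayFactor hr hR ht hT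
      _ = _ := by ring
  have h := pow_le_pow_left₀ (by positivity) key 100
  simpa only [mul_pow, inv_pow, zpow_neg, zpow_ofNat] using h

theorem decayFactor_sq_le (hr : 0 < r) (y : ℝ) :
    decayFactor R r |y| ^ 2 ≤ 4 * ((1 + |(⌊-y / r⌋ : ℝ)|) ^ 2)⁻¹ + (r / R) ^ 2 := by
  have hy : |y| / r = |-y / r| := by rw [abs_div, abs_neg, abs_of_pos hr]
  have hfl : |(⌊-y / r⌋ : ℝ)| ≤ |-y / r| + 1 := by
    have h1 := Int.floor_le (-y / r)
    have h2 := Int.lt_floor_add_one (-y / r)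
    rw [abs_le]
    constructor
    · linarith [neg_abs_le (-y / r)]
    · linarith [le_abs_self (-y / r)]
  have hpos : 0 < 1 + |y| / r := by positivity
  have h : (1 + |y| / r)⁻¹ ≤ 2 * (1 + |(⌊-y / r⌋ : ℝ)|)⁻¹ := by
    rw [inv_le_iff_one_le_mul₀ hpos, mul_assoc, mul_comm, mul_assoc, ← div_eq_inv_mul,
      le_div_iff₀ (by positivity)]
    linarith [abs_nonneg (-y / r)]
  have h4 : ((1 + |y| / r)⁻¹) ^ 2 ≤ 4 * ((1 + |(⌊-y / r⌋ : ℝ)|) ^ 2)⁻¹ := by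
    calc ((1 + |y| / r)⁻¹) ^ 2 ≤ (2 * (1 + |(⌊-y / r⌋ : ℝ)|)⁻¹) ^ 2 := by gcongr
      _ = _ := by rw [mul_pow, inv_pow]; norm_num
  unfold decayFactor
  rcases max_cases (1 + |y| / r)⁻¹ (r / R) with ⟨e, -⟩ | ⟨e, -⟩ <;> rw [e]
  · linarith [sq_nonneg (r / R)]
  · have : 0 ≤ 4 * ((1 + |(⌊-y / r⌋ : ℝ)|) ^ 2)⁻¹ := by positivity
    linarith

end DecayFactor

theorem summable_inv_one_add_abs_int_sq :
    Summable fun i : ℤ => 4 * ((1 + |(i : ℝ)|) ^ 2)⁻¹ := by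
  refine Summable.mul_left _ ?_
  have h : Summable fun n : ℕ => ((1 + |(n : ℝ)|) ^ 2)⁻¹ := by
    have := (summable_nat_add_iff 1).2 (Real.summable_nat_pow_inv.2 (one_lt_two))
    refine this.congr fun n => ?_
    rw [abs_of_nonneg (Nat.cast_nonneg n), add_comm]
    push_cast
    rfl
  refine Summable.of_nat_of_neg ?_ ?_
  · simpa using h
  · simpa using h

theorem sum_Icc_floor_le {R r a b : ℝ} (hr : 0 < r) (hR : r < R) (hab : b - a = R) :
    ∑ i ∈ Finset.Icc ⌊a / r⌋ ⌊b / r⌋, (4 * ((1 + |(i : ℝ)|) ^ 2)⁻¹ + (r / R) ^ 2) ≤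
      ∑' i : ℤ, 4 * ((1 + |(i : ℝ)|) ^ 2)⁻¹ + 3 := by
  have hR0 : 0 < R := hr.trans hR
  rw [Finset.sum_add_distrib]
  refine add_le_add
    (summable_inv_one_add_abs_int_sq.sum_le_tsum _ fun i _ => by positivity) ?_
  rw [Finset.sum_const, Int.card_Icc, nsmul_eq_mul]
  have hle : ⌊a / r⌋ ≤ ⌊b / r⌋ := Int.floor_le_floor (by gcongr; linarith)
  have hcast : (((⌊b / r⌋ + 1 - ⌊a / r⌋).toNat : ℕ) : ℝ) = ⌊b / r⌋ + 1 - ⌊a / r⌋ := by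
    have := Int.toNat_of_nonneg (show 0 ≤ ⌊b / r⌋ + 1 - ⌊a / r⌋ by omega)
    exact_mod_cast congrArg (Int.cast : ℤ → ℝ) this
  have hcard : ((⌊b / r⌋ : ℝ) + 1 - ⌊a / r⌋) ≤ R / r + 2 := by
    have h1 := Int.floor_le (b / r)
    have h2 := Int.lt_floor_add_one (a / r)
    have h3 : b / r - a / r = R / r := by rw [← sub_div, hab]
    linarith
  have hρ : r / R ≤ 1 := (div_le_one hR0).2 hR.le
  have hρ0 : 0 ≤ r / R := by positivity
  have hmul : R / r * (r / R) = 1 := by field_simp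
  rw [hcast]
  calc ((⌊b / r⌋ : ℝ) + 1 - ⌊a / r⌋) * (r / R) ^ 2 ≤ (R / r + 2) * (r / R) ^ 2 := by gcongr
    _ = (R / r * (r / R)) * (r / R) + 2 * (r / R) ^ 2 := by ring
    _ ≤ 3 := by rw [hmul]; nlinarith

section Cover

variable {K R r : ℝ} {c : ℝ × ℝ} {s : Finset (ℝ × ℝ)}

theorem abs_sub_le_of_mem_cover (hr : 0 < r)
    (hs : ∀ x : ℝ × ℝ, ∑ d ∈ s, (sqr d r).indicator (fun _ => (1 : ℝ)) x ≤
      K * (sqr c R).indicator (fun _ => (1 : ℝ)) x) {d : ℝ × ℝ} (hd : d ∈ s) :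
    |d.1 - c.1| ≤ R / 2 ∧ |d.2 - c.2| ≤ R / 2 := by
  have hmem : d ∈ sqr c R := by
    by_contra hn
    have h := hs d
    rw [Set.indicator_of_notMem hn, mul_zero] at h
    have h1 := Finset.single_le_sum
      (f := fun e => (sqr e r).indicator (fun _ => (1 : ℝ)) d)
      (fun e _ => Set.indicator_nonneg (fun _ _ => zero_le_one) _) hd
    have hdd : d ∈ sqr d r := by
      simp only [sqr, Set.mem_prod, Set.mem_Icc]
      refine ⟨⟨?_, ?_⟩, ?_, ?_⟩ <;> linarith
    simp only [Set.indicator_of_mem hdd] at h1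
    linarith
  simp only [sqr, Set.mem_prod, Set.mem_Icc] at hmem
  obtain ⟨⟨h1, h2⟩, h3, h4⟩ := hmem
  constructor <;> rw [abs_le] <;> constructor <;> linarith

theorem card_cell_le (hK : 0 ≤ K) (hr : 0 < r)
    (hs : ∀ x : ℝ × ℝ, ∑ d ∈ s, (sqr d r).indicator (fun _ => (1 : ℝ)) x ≤
      K * (sqr c R).indicator (fun _ => (1 : ℝ)) x) (x : ℝ × ℝ) (p : ℤ × ℤ) :
    ((s.filter fun d => (⌊-(x.1 - d.1) / r⌋, ⌊-(x.2 - d.2) / r⌋) = p).card : ℝ) ≤ K := by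
  set m : ℝ × ℝ := (x.1 + (p.1 + 1 / 2) * r, x.2 + (p.2 + 1 / 2) * r) with hm
  have h := hs m
  have hub : K * (sqr c R).indicator (fun _ => (1 : ℝ)) m ≤ K := by
    refine mul_le_of_le_one_right hK ?_
    exact Set.indicator_le_self' (fun _ _ => zero_le_one) m
  refine le_trans ?_ (h.trans hub)
  rw [Finset.card_eq_sum_ones, Nat.cast_sum]
  refine le_trans (Finset.sum_le_sum fun d hd => ?_)
    (Finset.sum_le_sum_of_subset_of_nonneg (Finset.filter_subset _ s)
      fun e _ _ => Set.indicator_nonneg (fun _ _ => zero_le_one) _)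
  have hp := (Finset.mem_filter.1 hd).2
  have cell : ∀ {y : ℝ} {k : ℤ}, ⌊-y / r⌋ = k → k * r ≤ -y ∧ -y < (k + 1) * r := by
    intro y k hk
    rw [Int.floor_eq_iff, le_div_iff₀ hr, div_lt_iff₀ hr] at hk
    exact hk
  obtain ⟨h1, h2⟩ := cell (congrArg Prod.fst hp)
  obtain ⟨h3, h4⟩ := cell (congrArg Prod.snd hp)
  have hmem : m ∈ sqr d r := by
    simp only [sqr, Set.mem_prod, Set.mem_Icc, hm]
    refine ⟨⟨?_, ?_⟩, ?_, ?_⟩ <;> linarith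
  rw [Set.indicator_of_mem hmem, Nat.cast_one]

theorem sum_decayFactor_sq_le (hK : 0 ≤ K) (hr : 0 < r) (hR : r < R)
    (hs : ∀ x : ℝ × ℝ, ∑ d ∈ s, (sqr d r).indicator (fun _ => (1 : ℝ)) x ≤
      K * (sqr c R).indicator (fun _ => (1 : ℝ)) x) (x : ℝ × ℝ) :
    ∑ d ∈ s, decayFactor R r |x.1 - d.1| ^ 2 * decayFactor R r |x.2 - d.2| ^ 2 ≤
      (∑' i : ℤ, 4 * ((1 + |(i : ℝ)|) ^ 2)⁻¹ + 3) ^ 2 * K := by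
  set F : ℤ → ℝ := fun i => 4 * ((1 + |(i : ℝ)|) ^ 2)⁻¹ + (r / R) ^ 2
  have hF0 : ∀ i, 0 ≤ F i := fun i => by positivity
  set S : ℝ := ∑' i : ℤ, 4 * ((1 + |(i : ℝ)|) ^ 2)⁻¹ + 3
  set I : Finset ℤ := Finset.Icc ⌊(c.1 - R / 2 - x.1) / r⌋ ⌊(c.1 + R / 2 - x.1) / r⌋
  set J : Finset ℤ := Finset.Icc ⌊(c.2 - R / 2 - x.2) / r⌋ ⌊(c.2 + R / 2 - x.2) / r⌋
  set cell : ℝ × ℝ → ℤ × ℤ := fun d => (⌊-(x.1 - d.1) / r⌋, ⌊-(x.2 - d.2) / r⌋)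
  have hI : ∑ i ∈ I, F i ≤ S := sum_Icc_floor_le hr hR (by ring)
  have hJ : ∑ j ∈ J, F j ≤ S := sum_Icc_floor_le hr hR (by ring)
  have hmaps : ∀ d ∈ s, cell d ∈ I ×ˢ J := by
    intro d hd
    obtain ⟨h1, h2⟩ := abs_sub_le_of_mem_cover hr hs hd
    rw [abs_le] at h1 h2
    rw [Finset.mem_product, Finset.mem_Icc, Finset.mem_Icc]
    refine ⟨⟨?_, ?_⟩, ?_, ?_⟩ <;> refine Int.floor_le_floor ?_ <;> gcongr <;> linarith
  calc ∑ d ∈ s, decayFactor R r |x.1 - d.1| ^ 2 * decayFactor R r |x.2 - d.2| ^ 2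
      ≤ ∑ d ∈ s, F (cell d).1 * F (cell d).2 := Finset.sum_le_sum fun d _ =>
        mul_le_mul (decayFactor_sq_le hr _) (decayFactor_sq_le hr _) (sq_nonneg _) (hF0 _)
    _ = ∑ p ∈ I ×ˢ J, ∑ d ∈ s with cell d = p, F (cell d).1 * F (cell d).2 :=
        (Finset.sum_fiberwise_of_maps_to hmaps _).symm
    _ ≤ ∑ p ∈ I ×ˢ J, K * (F p.1 * F p.2) := by
        refine Finset.sum_le_sum fun p _ => ?_
        rw [Finset.sum_congr rfl (g := fun _ => F p.1 * F p.2)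
          fun d hd => by rw [(Finset.mem_filter.1 hd).2], Finset.sum_const, nsmul_eq_mul]
        exact mul_le_mul_of_nonneg_right (card_cell_le hK hr hs x p)
          (mul_nonneg (hF0 _) (hF0 _))
    _ = K * ((∑ i ∈ I, F i) * ∑ j ∈ J, F j) := by
        rw [← Finset.mul_sum, Finset.sum_mul_sum, Finset.sum_product]
    _ ≤ K * (S * S) := by
        have hS := (Finset.sum_nonneg fun i _ => hF0 i).trans hI
        exact mul_le_mul_of_nonneg_left
          (mul_le_mul hI hJ (Finset.sum_nonneg fun j _ => hF0 j) hS) hK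
    _ = S ^ 2 * K := by ring

end Cover

theorem sqrt_add_sq_le_add (a b a' b' : ℝ) :
    √((a + a') ^ 2 + (b + b') ^ 2) ≤ √(a ^ 2 + b ^ 2) + √(a' ^ 2 + b' ^ 2) := by
  rw [← Complex.norm_add_mul_I, ← Complex.norm_add_mul_I, ← Complex.norm_add_mul_I]
  refine le_of_eq_of_le (congrArg norm ?_) (norm_add_le _ _)
  push_cast
  ring

section Pointwise

variable {R r : ℝ} {c d : ℝ × ℝ}

theorem wB_le_of_mem (hr : 0 < r) (hR : r < R) (h1 : |d.1 - c.1| ≤ R / 2)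
    (h2 : |d.2 - c.2| ≤ R / 2) (x : ℝ × ℝ) :
    wB d r x ≤ 3 ^ 100 * wB c R x *
      (decayFactor R r |x.1 - d.1| ^ 2 * decayFactor R r |x.2 - d.2| ^ 2) := by
  have hR0 : 0 < R := hr.trans hR
  set t := √((x.1 - d.1) ^ 2 + (x.2 - d.2) ^ 2) with ht
  have ht0 : 0 ≤ t := Real.sqrt_nonneg _
  have hdc : √((d.1 - c.1) ^ 2 + (d.2 - c.2) ^ 2) ≤ R := by
    refine Real.sqrt_le_iff.2 ⟨hR0.le, ?_⟩
    have h3 := sq_le_sq' (abs_le.1 h1).1 (abs_le.1 h1).2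
    have h4 := sq_le_sq' (abs_le.1 h2).1 (abs_le.1 h2).2
    nlinarith
  have hT : √((x.1 - c.1) ^ 2 + (x.2 - c.2) ^ 2) ≤ t + R := by
    have h := sqrt_add_sq_le_add (x.1 - d.1) (x.2 - d.2) (d.1 - c.1) (d.2 - c.2)
    simp only [sub_add_sub_cancel] at h
    linarith
  refine (one_add_div_zpow_le hr hR ht0 (Real.sqrt_nonneg _) hT).trans ?_
  have h1t : |x.1 - d.1| ≤ t := Real.abs_le_sqrt (by linarith [sq_nonneg (x.2 - d.2)])
  have h2t : |x.2 - d.2| ≤ t := Real.abs_le_sqrt (by linarith [sq_nonneg (x.1 - d.1)])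
  have hn : ∀ y, 0 ≤ decayFactor R r y := fun y => decayFactor_nonneg hr hR
  unfold wB
  refine mul_le_mul_of_nonneg_left ?_ (by positivity)
  calc decayFactor R r t ^ 100 ≤ decayFactor R r t ^ 4 :=
        pow_le_pow_of_le_one (hn _) (decayFactor_le_one hr hR ht0) (by norm_num)
    _ = decayFactor R r t ^ 2 * decayFactor R r t ^ 2 := by ring
    _ ≤ _ := mul_le_mul
        (pow_le_pow_left₀ (hn _) (decayFactor_anti hr (abs_nonneg _) h1t) 2)
        (pow_le_pow_left₀ (hn _) (decayFactor_anti hr (abs_nonneg _) h2t) 2)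
        (sq_nonneg _) (sq_nonneg _)

theorem wtB_le_of_mem (hr : 0 < r) (hR : r < R) (h1 : |d.1 - c.1| ≤ R / 2)
    (h2 : |d.2 - c.2| ≤ R / 2) (x : ℝ × ℝ) :
    wtB d r x ≤ 3 ^ 200 * wtB c R x *
      (decayFactor R r |x.1 - d.1| ^ 2 * decayFactor R r |x.2 - d.2| ^ 2) := by
  have hR0 : 0 < R := hr.trans hR
  have line : ∀ a b y : ℝ, |b - a| ≤ R / 2 →
      (1 + |y - b| / r) ^ (-100 : ℤ) ≤
        3 ^ 100 * (1 + |y - a| / R) ^ (-100 : ℤ) * decayFactor R r |y - b| ^ 2 := by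
    intro a b y hab
    refine (one_add_div_zpow_le hr hR (abs_nonneg _) (abs_nonneg (y - a)) ?_).trans ?_
    · linarith [abs_sub_le y b a]
    · refine mul_le_mul_of_nonneg_left ?_ (by positivity)
      exact pow_le_pow_of_le_one (decayFactor_nonneg hr hR)
        (decayFactor_le_one hr hR (abs_nonneg _)) (by norm_num)
  unfold wtB
  refine (mul_le_mul (line c.1 d.1 x.1 h1) (line c.2 d.2 x.2 h2) (by positivity)
    (by positivity)).trans_eq ?_
  ring

end Pointwise

/-- if `ℬ` is a `K`-fold overlapping cover of the square `B` by squares of side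
`R' < R`, then `Σ_{Δ ∈ ℬ} w_Δ ≤ cK w_B`, and the same for the product weights `w̃`. -/
theorem weight_partition_sum :
    ∃ c : ℝ, 0 < c ∧ ∀ K : ℝ, 1 ≤ K → ∀ (cB : ℝ × ℝ) (R R' : ℝ), 0 < R' → R' < R →
      ∀ s : Finset (ℝ × ℝ),
        (∀ x : ℝ × ℝ, ∑ d ∈ s, (sqr d R').indicator (fun _ => (1 : ℝ)) x ≤
            K * (sqr cB R).indicator (fun _ => (1 : ℝ)) x) →
        (∀ x : ℝ × ℝ, ∑ d ∈ s, wB d R' x ≤ c * K * wB cB R x) ∧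
        (∀ x : ℝ × ℝ, ∑ d ∈ s, wtB d R' x ≤ c * K * wtB cB R x) := by
  set S : ℝ := (∑' i : ℤ, 4 * ((1 + |(i : ℝ)|) ^ 2)⁻¹ + 3) ^ 2
  have hS0 : 0 < S := by
    have : 0 ≤ ∑' i : ℤ, 4 * ((1 + |(i : ℝ)|) ^ 2)⁻¹ := tsum_nonneg fun i => by positivity
    positivity
  refine ⟨3 ^ 200 * S, by positivity, fun K hK c R r hr hR s hs => ?_⟩
  have hK0 : 0 ≤ K := zero_le_one.trans hK
  have hR0 : 0 < R := hr.trans hR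
  have bound : ∀ (w : ℝ × ℝ → ℝ) (W A : ℝ) (x : ℝ × ℝ), 0 ≤ W → 0 ≤ A → A ≤ 3 ^ 200 →
      (∀ d ∈ s, w d ≤ A * W *
        (decayFactor R r |x.1 - d.1| ^ 2 * decayFactor R r |x.2 - d.2| ^ 2)) →
      ∑ d ∈ s, w d ≤ 3 ^ 200 * S * K * W := by
    intro w W A x hW hA0 hA h
    calc ∑ d ∈ s, w d ≤ A * W * ∑ d ∈ s,
          decayFactor R r |x.1 - d.1| ^ 2 * decayFactor R r |x.2 - d.2| ^ 2 := by
          rw [Finset.mul_sum]; exact Finset.sum_le_sum h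
      _ ≤ A * W * (S * K) := by gcongr; exact sum_decayFactor_sq_le hK0 hr hR hs x
      _ ≤ 3 ^ 200 * W * (S * K) := by gcongr
      _ = 3 ^ 200 * S * K * W := by ring
  constructor
  · refine fun x => bound _ _ (3 ^ 100) x ?_ (by positivity)
      (pow_le_pow_right₀ (by norm_num) (by norm_num)) fun d hd => ?_
    · unfold wB; positivity
    · obtain ⟨h1, h2⟩ := abs_sub_le_of_mem_cover hr hs hd
      exact wB_le_of_mem hr hR h1 h2 x
  · refine fun x => bound _ _ (3 ^ 200) x ?_ (by positivity) le_rfl fun d hd => ?_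
    · unfold wtB; positivity
    · obtain ⟨h1, h2⟩ := abs_sub_le_of_mem_cover hr hs hd
      exact wtB_le_of_mem hr hR h1 h2 x
end
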